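/- arXiv:2207.12584 — 3 statements merged into one kernel-verified Lean document; each statement's English description precedes it below -/
import Mathlib

section
/- Let n ≥ q+3 and 2 ≤ k ≤ n−2, and assume that at least one of the following holds: (1) n ≥ q+k, or (2) q is a prime, or (3) k ≤ √q. Then the minimum distance of the functional elliptic code C_L(D,kO) equals n−k. -/
open Matrix BigOperators

/-- Values of the `k` monomials `x^i y^j` (`j ∈ {0,1}`, `2i+3j ≤ k`), a basis of the
Riemann–Roch space `L(kO)`, at an affine point `P = (α, β)`:
`(1, α, …, α^⌊k/2⌋, β, αβ, …, α^⌊(k−3)/2⌋ β)`. -/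
def phiAff {F : Type*} [Field F] (k : ℕ) (P : F × F) : Fin k → F :=
  fun j => if (j : ℕ) ≤ k / 2 then P.1 ^ (j : ℕ) else P.2 * P.1 ^ ((j : ℕ) - k / 2 - 1)

/-- The vector `φ_k(O)` attached to the point at infinity: the standard unit vector supported
at the coordinate of `x^{k/2}` (`k` even) resp. `x^{(k-3)/2} y` (`k` odd). -/
def phiInf (F : Type*) [Field F] (k : ℕ) : Fin k → F :=
  fun j => if (j : ℕ) = (if k % 2 = 0 then k / 2 else k - 1) then 1 else 0

/-- The parity-check matrix `H(k)` with columns `φ_k(P_1), …, φ_k(P_n)`. -/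
def Hmat {F : Type*} [Field F] {n : ℕ} (k : ℕ) (P : Fin n → F × F) :
    Matrix (Fin k) (Fin n) F := fun i j => phiAff k (P j) i

/-- The functional elliptic code `C_L(D, kO)`: the row space of `H(k)`. -/
def funcCode {F : Type*} [Field F] {n : ℕ} (k : ℕ) (P : Fin n → F × F) :
    Set (Fin n → F) := {v | ∃ u : Fin k → F, v = Matrix.vecMul u (Hmat k P)}

/-- The residue elliptic code `C_Ω(D, kO) = {v : H(k) vᵀ = 0}`. -/
def resCode {F : Type*} [Field F] {n : ℕ} (k : ℕ) (P : Fin n → F × F) :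
    Set (Fin n → F) := {v | Matrix.mulVec (Hmat k P) v = 0}

/-- Error distance `d(v, C)` from a word to a code. -/
noncomputable def dTo {F : Type*} [DecidableEq F] {n : ℕ} (v : Fin n → F) (C : Set (Fin n → F)) : ℕ :=
  sInf (hammingDist v '' C)

/-- Covering radius `ρ(C) = max_v d(v, C)`. -/
noncomputable def covRad {F : Type*} [DecidableEq F] {n : ℕ} (C : Set (Fin n → F)) : ℕ :=
  sSup (Set.range fun v : Fin n → F => dTo v C)

/-- Minimum distance: the least Hamming weight of a nonzero codeword. -/
noncomputable def minDist {F : Type*} [DecidableEq F] [Zero F] {n : ℕ} (C : Set (Fin n → F)) : ℕ :=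
  sInf ((fun c => hammingDist c 0) '' (C \ {0}))

/-- Dimension of a code (as the dimension of its linear span). -/
noncomputable def dimCode (F : Type*) [Field F] {n : ℕ} (C : Set (Fin n → F)) : ℕ :=
  Module.finrank F (Submodule.span F C)

/-- `(α, β)` is an affine rational point of the curve `y² = x³ + s x + t`. -/
def onCurve {F : Type*} [Field F] (s t : F) (P : F × F) : Prop :=
  P.2 ^ 2 = P.1 ^ 3 + s * P.1 + t

/-- The number `|E(F_q)|` of rational points: affine points plus the point at infinity. -/
def numPoints (F : Type*) [Field F] [Fintype F] [DecidableEq F] (s t : F) : ℕ :=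
  (Finset.univ.filter (fun P : F × F => P.2 ^ 2 = P.1 ^ 3 + s * P.1 + t)).card + 1


section SubsetSums

variable {G : Type*} [AddCommGroup G] [DecidableEq G]

/-- The elements `x` of `D` that have a partner `c - x ∈ D` different from `x`. -/
def partnered (D : Finset G) (c : G) : Finset G := D.filter fun x => c - x ∈ D ∧ c - x ≠ x

theorem mem_partnered {D : Finset G} {c x : G} :
    x ∈ partnered D c ↔ x ∈ D ∧ c - x ∈ D ∧ c - x ≠ x := by
  simp [partnered]

theorem exists_subset_sum_eq_nsmul {T : Finset G} {c : G} (hT : ∀ x ∈ T, c - x ∈ T ∧ c - x ≠ x)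
    (m : ℕ) (hm : 2 * m ≤ T.card + 1) :
    ∃ A ⊆ T, A.card = 2 * m ∧ (∀ x ∈ A, c - x ∈ A) ∧ ∑ x ∈ A, x = m • c := by
  induction m with
  | zero => exact ⟨∅, by simp⟩
  | succ m ih =>
    obtain ⟨A, hAT, hA, hcl, hsum⟩ := ih (by omega)
    obtain ⟨x, hxT, hxA⟩ := Finset.exists_mem_notMem_of_card_lt_card (s := A) (t := T) (by omega)
    obtain ⟨hcT, hne⟩ := hT x hxT
    have hcA : c - x ∉ A := fun h => hxA (by simpa using hcl _ h)
    have hx' : x ∉ insert (c - x) A := by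
      simp [hxA, hne.symm]
    refine ⟨insert x (insert (c - x) A), ?_, ?_, ?_, ?_⟩
    · intro z hz
      simp only [Finset.mem_insert] at hz
      rcases hz with rfl | rfl | hz
      exacts [hxT, hcT, hAT hz]
    · rw [Finset.card_insert_of_notMem hx', Finset.card_insert_of_notMem hcA, hA]; ring
    · intro z hz
      simp only [Finset.mem_insert] at hz ⊢
      rcases hz with rfl | rfl | hz
      · simp
      · simp
      · exact Or.inr (Or.inr (hcl z hz))
    · rw [Finset.sum_insert hx', Finset.sum_insert hcA, hsum, succ_nsmul]; abel

theorem exists_subset_sum_eq_nsmul_add {D R : Finset G} {c : G} (hR : R ⊆ D) (m : ℕ)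
    (hm : 2 * m + 2 * R.card ≤ (partnered D c).card + 1) :
    ∃ A ⊆ D, A.card = 2 * m + R.card ∧ ∑ x ∈ A, x = m • c + ∑ x ∈ R, x := by
  set T := partnered D c \ (R ∪ R.image (c - ·)) with hTdef
  have hcard : (R ∪ R.image (c - ·)).card ≤ 2 * R.card := by
    have h1 := Finset.card_union_le R (R.image (c - ·))
    have h2 : (R.image (c - ·)).card ≤ R.card := Finset.card_image_le
    omega
  have hTc := Finset.le_card_sdiff (R ∪ R.image (c - ·)) (partnered D c)
  have hT : ∀ x ∈ T, c - x ∈ T ∧ c - x ≠ x := by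
    intro x hx
    simp only [hTdef, Finset.mem_sdiff, Finset.mem_union, Finset.mem_image, mem_partnered,
      not_or, not_exists, not_and] at hx ⊢
    obtain ⟨⟨hxD, hcD, hne⟩, hxR, hxR'⟩ := hx
    refine ⟨⟨⟨hcD, by simpa using hxD, by simpa using hne.symm⟩, ?_, ?_⟩, hne⟩
    · intro h; exact hxR' _ h (by simp)
    · intro y hy h
      exact hxR (by rwa [← sub_right_injective h])
  rw [← hTdef] at hTc
  obtain ⟨A, hAT, hA, -, hsum⟩ := exists_subset_sum_eq_nsmul hT m (by omega)
  have hdisj : Disjoint A R := by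
    rw [Finset.disjoint_left]
    intro x hx hxR
    have := hAT hx
    simp [hTdef, hxR] at this
  refine ⟨A ∪ R, Finset.union_subset ?_ hR, ?_, ?_⟩
  · intro x hx
    exact (mem_partnered.1 (Finset.mem_sdiff.1 (hAT hx)).1).1
  · rw [Finset.card_union_of_disjoint hdisj, hA]
  · rw [Finset.sum_union hdisj, hsum]

variable [Fintype G]

theorem sum_card_partnered (D : Finset G) :
    ∑ c, (partnered D c).card = D.card * (D.card - 1) := by
  have h : D.card * (D.card - 1) = D.offDiag.card := by
    rw [Finset.offDiag_card, Nat.mul_sub, mul_one]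
  rw [h, Finset.card_eq_sum_card_fiberwise (f := fun p : G × G => p.1 + p.2) (t := Finset.univ)
    (fun _ _ => Finset.mem_coe.2 (Finset.mem_univ _))]
  refine Finset.sum_congr rfl fun c _ => ?_
  refine Finset.card_bij (fun x _ => (x, c - x)) ?_ ?_ ?_
  · intro x hx
    obtain ⟨h1, h2, h3⟩ := mem_partnered.1 hx
    simp [h1, h2, h3.symm]
  · intro x _ y _ hxy
    exact (Prod.ext_iff.1 hxy).1
  · rintro ⟨x, y⟩ hxy
    simp only [Finset.mem_filter, Finset.mem_offDiag] at hxy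
    obtain ⟨⟨hx, hy, hne⟩, rfl⟩ := hxy
    exact ⟨x, mem_partnered.2 (by simp [hx, hy, hne.symm]), by simp⟩

theorem two_mul_card_le_card_partnered_add (D : Finset G) (g : G) :
    2 * D.card ≤ (partnered D g).card + (Finset.univ.filter fun x : G => x + x = g).card
      + Fintype.card G := by
  have hinj : (D.image (g - ·)).card = D.card :=
    Finset.card_image_of_injective _ sub_right_injective
  have h1 := Finset.card_union_add_card_inter D (D.image (g - ·))
  have h2 := Finset.card_le_univ (D ∪ D.image (g - ·))
  have h3 : D ∩ D.image (g - ·) ⊆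
      partnered D g ∪ Finset.univ.filter fun x : G => x + x = g := by
    intro x hx
    simp only [Finset.mem_inter, Finset.mem_image] at hx
    obtain ⟨hx, y, hy, rfl⟩ := hx
    simp only [Finset.mem_union, mem_partnered, Finset.mem_filter, Finset.mem_univ, true_and]
    by_cases h : g - y + (g - y) = g
    · exact Or.inr h
    · refine Or.inl ⟨hx, by simpa using hy, fun h' => h ?_⟩
      nth_rewrite 1 [← h']
      simp
  have h4 := (Finset.card_le_card h3).trans (Finset.card_union_le _ _)
  omega

theorem exists_pair_sum_eq {D : Finset G}
    (h2 : ∀ g : G, (Finset.univ.filter fun x : G => x + x = g).card ≤ 4)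
    (hD : Fintype.card G + 5 ≤ 2 * D.card) (g : G) :
    ∃ R ⊆ D, R.card = 2 ∧ ∑ x ∈ R, x = g := by
  have h := two_mul_card_le_card_partnered_add D g
  have := h2 g
  obtain ⟨x, hx⟩ := Finset.card_pos.1 (show 0 < (partnered D g).card by omega)
  obtain ⟨hx, hy, hne⟩ := mem_partnered.1 hx
  refine ⟨{x, g - x}, ?_, Finset.card_pair hne.symm, ?_⟩
  · intro z hz
    simp only [Finset.mem_insert, Finset.mem_singleton] at hz
    rcases hz with rfl | rfl <;> assumption
  · rw [Finset.sum_pair hne.symm]; abel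

theorem exists_triple_sum_eq {D : Finset G} (hD : Fintype.card G + 5 ≤ 2 * D.card) (g : G) :
    ∃ R ⊆ D, R.card = 3 ∧ ∑ x ∈ R, x = g := by
  obtain ⟨d, hd, hd2⟩ : ∃ d ∈ D, (Finset.univ.filter fun x : G => x + x = g - d).card ≤ 2 := by
    by_contra! hcon
    have h1 : D.card * 3 ≤ ∑ d ∈ D, (Finset.univ.filter fun x : G => x + x = g - d).card := by
      rw [← smul_eq_mul]
      exact Finset.card_nsmul_le_sum _ _ _ fun d hd => hcon d hd
    have h3 : ∑ d ∈ D, (Finset.univ.filter fun x : G => x + x = g - d).card ≤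
        Fintype.card G := by
      rw [← Finset.card_biUnion]
      · exact Finset.card_le_univ _
      · intro a _ b _ hab
        refine Finset.disjoint_left.2 fun x hx hx' => ?_
        simp only [Finset.mem_filter, Finset.mem_univ, true_and] at hx hx'
        exact hab (sub_right_injective (hx.symm.trans hx'))
    omega
  have h := two_mul_card_le_card_partnered_add D (g - d)
  obtain ⟨x, hx, hxn⟩ := Finset.exists_mem_notMem_of_card_lt_card
    (s := {d, g - d - d}) (t := partnered D (g - d))
    (lt_of_le_of_lt Finset.card_le_two (by omega))
  obtain ⟨hx, hy, hne⟩ := mem_partnered.1 hx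
  simp only [Finset.mem_insert, Finset.mem_singleton, not_or] at hxn
  have hyd : g - d - x ≠ d := fun h => hxn.2 (by rw [sub_eq_iff_eq_add.1 h, add_sub_cancel_left])
  have hxy : x ∉ ({g - d - x, d} : Finset G) := by simp [hxn.1, hne.symm]
  have hyd' : g - d - x ∉ ({d} : Finset G) := by simpa using hyd
  refine ⟨{x, g - d - x, d}, ?_, ?_, ?_⟩
  · intro z hz
    simp only [Finset.mem_insert, Finset.mem_singleton] at hz
    rcases hz with rfl | rfl | rfl <;> assumption
  · rw [Finset.card_insert_of_notMem hxy, Finset.card_insert_of_notMem hyd',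
      Finset.card_singleton]
  · rw [Finset.sum_insert hxy, Finset.sum_insert hyd', Finset.sum_singleton]; abel

theorem exists_subset_sum_eq_of_two_mul_le {D : Finset G}
    (h2 : ∀ g : G, (Finset.univ.filter fun x : G => x + x = g).card ≤ 4)
    (hD : Fintype.card G + 5 ≤ 2 * D.card) {k : ℕ} (hk : 2 ≤ k) (hkn : 2 * k ≤ D.card) (g : G) :
    ∃ A ⊆ D, A.card = k ∧ ∑ x ∈ A, x = g := by
  have hsum := sum_card_partnered D
  obtain ⟨n, hn⟩ : ∃ n, D.card = n + 1 := ⟨D.card - 1, by omega⟩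
  rw [hn, Nat.add_sub_cancel] at hsum
  rcases Nat.even_or_odd' k with ⟨m, rfl | rfl⟩
  · obtain ⟨m, rfl⟩ : ∃ m', m = m' + 1 := ⟨m - 1, by omega⟩
    obtain ⟨c, hc⟩ : ∃ c, 2 * m + 3 ≤ (partnered D c).card := by
      by_contra! hcon
      have h : ∑ c, (partnered D c).card ≤ Fintype.card G * (2 * m + 2) := by
        rw [← smul_eq_mul]
        exact Finset.sum_le_card_nsmul _ _ _ fun c _ => by have := hcon c; omega
      nlinarith
    obtain ⟨R, hR, hR2, hRs⟩ := exists_pair_sum_eq h2 hD (g - m • c)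
    obtain ⟨A, hA, hAc, hAs⟩ := exists_subset_sum_eq_nsmul_add (c := c) hR m (by omega)
    exact ⟨A, hA, by omega, by rw [hAs, hRs]; abel⟩
  · obtain ⟨m, rfl⟩ : ∃ m', m = m' + 1 := ⟨m - 1, by omega⟩
    by_cases hmax : ∃ c, 2 * m + 5 ≤ (partnered D c).card
    · obtain ⟨c, hc⟩ := hmax
      obtain ⟨R, hR, hR3, hRs⟩ := exists_triple_sum_eq hD (g - m • c)
      obtain ⟨A, hA, hAc, hAs⟩ := exists_subset_sum_eq_nsmul_add (c := c) hR m (by omega)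
      exact ⟨A, hA, by omega, by rw [hAs, hRs]; abel⟩
    · push Not at hmax
      have h : ∑ c, (partnered D c).card ≤ Fintype.card G * (2 * m + 4) := by
        rw [← smul_eq_mul]
        exact Finset.sum_le_card_nsmul _ _ _ fun c _ => by have := hmax c; omega
      have hn' : n = 4 * m + 5 := by
        by_contra hne
        have : 4 * m + 6 ≤ n := by omega
        nlinarith
      have hN : Fintype.card G = 8 * m + 7 := by
        by_contra hne
        have : Fintype.card G ≤ 8 * m + 6 := by omega
        nlinarith
      have hinj : Function.Injective fun c : G => g - (m + 1) • c := by
        intro a b hab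
        have hab' : (m + 1) • (a - b) = 0 := by
          rw [nsmul_sub, sub_right_injective hab, sub_self]
        have h0 : Fintype.card G • (a - b) = 0 := card_nsmul_eq_zero
        have h8 : (8 * (m + 1)) • (a - b) = 0 := by rw [mul_nsmul', hab', nsmul_zero]
        rw [show 8 * (m + 1) = Fintype.card G + 1 by omega, succ_nsmul, h0, zero_add] at h8
        exact sub_eq_zero.1 h8
      set S := Finset.univ.filter fun c : G => g - (m + 1) • c ∈ D with hS
      have hScard : S.card = D.card := by
        have hsurj := (Finite.injective_iff_surjective.1 hinj)
        refine Finset.card_bij (fun c _ => g - (m + 1) • c) ?_ ?_ ?_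
        · intro c hc; simpa [hS] using hc
        · intro a _ b _ hab; exact hinj hab
        · intro b hb
          obtain ⟨a, rfl⟩ := hsurj b
          exact ⟨a, by simpa [hS] using hb, rfl⟩
      obtain ⟨c, hcS, hc⟩ : ∃ c ∈ S, 2 * m + 3 ≤ (partnered D c).card := by
        by_contra! hcon
        have e1 : ∑ c ∈ S, (partnered D c).card ≤ S.card * (2 * m + 2) := by
          rw [← smul_eq_mul]
          exact Finset.sum_le_card_nsmul _ _ _ fun c hc => by have := hcon c hc; omega
        have e2 : ∑ c ∈ Sᶜ, (partnered D c).card ≤ Sᶜ.card * (2 * m + 4) := by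
          rw [← smul_eq_mul]
          exact Finset.sum_le_card_nsmul _ _ _ fun c _ => by have := hmax c; omega
        have e3 := Finset.sum_add_sum_compl S fun c => (partnered D c).card
        have e4 := Finset.card_add_card_compl S
        have e5 : Sᶜ.card = 4 * m + 1 := by omega
        rw [hScard, hn, hn'] at e1
        rw [e5] at e2
        subst hn'
        nlinarith
      obtain ⟨A, hA, hAc, hAs⟩ := exists_subset_sum_eq_nsmul_add (D := D)
        (R := {g - (m + 1) • c}) (c := c)
        (by simpa [hS] using hcS) (m + 1) (by rw [Finset.card_singleton]; omega)
      exact ⟨A, hA, by simpa using hAc, by rw [hAs, Finset.sum_singleton]; abel⟩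

/-- If `D` contains slightly more than half of a finite abelian group with few elements of
order two, then every element is a sum of `k` distinct elements of `D`, for `2 ≤ k ≤ |D| - 2`. -/
theorem exists_subset_sum_eq {D : Finset G}
    (h2 : ∀ g : G, (Finset.univ.filter fun x : G => x + x = g).card ≤ 4)
    (hD : Fintype.card G + 5 ≤ 2 * D.card) {k : ℕ} (hk : 2 ≤ k) (hkn : k + 2 ≤ D.card) (g : G) :
    ∃ A ⊆ D, A.card = k ∧ ∑ x ∈ A, x = g := by
  rcases le_total (2 * k) D.card with h | h
  · exact exists_subset_sum_eq_of_two_mul_le h2 hD hk h g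
  · obtain ⟨A, hA, hAc, hAs⟩ := exists_subset_sum_eq_of_two_mul_le h2 hD
      (k := D.card - k) (by omega) (by omega) (∑ x ∈ D, x - g)
    refine ⟨D \ A, Finset.sdiff_subset, ?_, ?_⟩
    · rw [Finset.card_sdiff_of_subset hA]; omega
    · have := Finset.sum_sdiff (f := fun x => x) hA
      rw [hAs] at this
      rw [eq_sub_of_add_eq this]; abel

end SubsetSums

section EllipticCodes

open Polynomial WeierstrassCurve
open scoped Polynomial.Bivariate

variable {F : Type*} [Field F]

theorem card_le_natDegree_of_zeros [DecidableEq F] {s t : F} {p q : F[X]}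
    (hN : p ^ 2 - q ^ 2 * (X ^ 3 + C s * X + C t) ≠ 0) (Z : Finset (F × F))
    (hZ : ∀ P ∈ Z, onCurve s t P ∧ p.eval P.1 + q.eval P.1 * P.2 = 0) :
    Z.card ≤ (p ^ 2 - q ^ 2 * (X ^ 3 + C s * X + C t)).natDegree := by
  set N := p ^ 2 - q ^ 2 * (X ^ 3 + C s * X + C t) with hNdef
  have hfib : ∀ a ∈ Z.image Prod.fst, (Z.filter fun P => P.1 = a).card ≤ N.roots.count a := by
    intro a ha
    rw [count_roots]
    rcases le_or_gt (Z.filter fun P => P.1 = a).card 1 with h1 | h1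
    · refine h1.trans ?_
      obtain ⟨⟨x, y⟩, hP, rfl⟩ := Finset.mem_image.1 ha
      obtain ⟨hc, h0⟩ := hZ _ hP
      refine (rootMultiplicity_pos hN).2 ?_
      simp only [onCurve] at hc h0
      simp only [hNdef, IsRoot, eval_sub, eval_pow, eval_mul, eval_add, eval_X, eval_C]
      rw [← hc]
      linear_combination (p.eval x - q.eval x * y) * h0
    · obtain ⟨⟨x, y⟩, hP, ⟨x', y'⟩, hP', hne⟩ := Finset.one_lt_card.1 h1
      simp only [Finset.mem_filter] at hP hP'
      obtain ⟨hP, rfl⟩ := hP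
      obtain ⟨hP', rfl⟩ := hP'
      obtain ⟨hc, h0⟩ := hZ _ hP
      obtain ⟨hc', h0'⟩ := hZ _ hP'
      simp only [onCurve] at hc h0 hc' h0'
      have hyy : y - y' ≠ 0 := fun h => hne (by rw [sub_eq_zero.1 h])
      have hq : q.eval x' = 0 :=
        (mul_eq_zero.1 (show q.eval x' * (y - y') = 0 by linear_combination h0 - h0')).resolve_right
          hyy
      have hp : p.eval x' = 0 := by simpa [hq] using h0
      have hdvd : (X - C x') ^ 2 ∣ N :=
        dvd_sub (pow_dvd_pow_of_dvd (dvd_iff_isRoot.2 hp) 2)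
          ((pow_dvd_pow_of_dvd (dvd_iff_isRoot.2 hq) 2).mul_right _)
      refine le_trans ?_ ((le_rootMultiplicity_iff hN).2 hdvd)
      have hsub : (Z.filter fun P => P.1 = x') ⊆ {(x', y), (x', -y)} := by
        rintro ⟨u, v⟩ huv
        obtain ⟨huZ, hux⟩ := Finset.mem_filter.1 huv
        have hv := (hZ _ huZ).1
        simp only [onCurve] at hv hux
        rw [hux] at hv ⊢
        rcases sq_eq_sq_iff_eq_or_eq_neg.1 (hv.trans hc.symm) with rfl | rfl <;> simp
      exact (Finset.card_le_card hsub).trans Finset.card_le_two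
  calc Z.card = ∑ a ∈ Z.image Prod.fst, (Z.filter fun P => P.1 = a).card :=
        Finset.card_eq_sum_card_image _ _
    _ ≤ ∑ a ∈ Z.image Prod.fst, N.roots.count a := Finset.sum_le_sum hfib
    _ ≤ N.roots.card := by
        rw [← Multiset.toFinset_sum_count_eq]
        refine Finset.sum_le_sum_of_ne_zero fun a _ ha => ?_
        exact Multiset.mem_toFinset.2 (Multiset.count_ne_zero.1 ha)
    _ ≤ N.natDegree := card_roots' _

/-- The curve `y² = x³ + s x + t`. -/
def shortWeierstrass (s t : F) : WeierstrassCurve F := ⟨0, 0, 0, s, t⟩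

theorem equation_shortWeierstrass_iff {s t : F} {P : F × F} :
    (shortWeierstrass s t).toAffine.Equation P.1 P.2 ↔ onCurve s t P := by
  simp [Affine.equation_iff, shortWeierstrass, onCurve]

theorem nonsingular_shortWeierstrass {s t : F} (h2 : (2 : F) ≠ 0)
    (hdisc : 4 * s ^ 3 + 27 * t ^ 2 ≠ 0) {P : F × F} (hP : onCurve s t P) :
    (shortWeierstrass s t).toAffine.Nonsingular P.1 P.2 := by
  refine (Affine.equation_iff_nonsingular_of_Δ_ne_zero ?_).1 (equation_shortWeierstrass_iff.2 hP)
  have : (shortWeierstrass s t).Δ = -(2 ^ 4 * (4 * s ^ 3 + 27 * t ^ 2)) := by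
    simp only [WeierstrassCurve.Δ, b₂, b₄, b₆, b₈, shortWeierstrass]
    ring
  rw [this]
  exact neg_ne_zero.2 (mul_ne_zero (pow_ne_zero _ h2) hdisc)

theorem norm_shortWeierstrass (s t : F) (p q : F[X]) :
    Algebra.norm F[X] (p • (1 : (shortWeierstrass s t).toAffine.CoordinateRing) +
      q • Affine.CoordinateRing.mk _ Y) = p ^ 2 - q ^ 2 * (X ^ 3 + C s * X + C t) := by
  rw [Affine.CoordinateRing.norm_smul_basis]
  simp [shortWeierstrass]

theorem eval_add_eval_mul_eq_zero_of_mem_XYIdeal {W : Affine F} {x y : F} (h : W.Equation x y)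
    {p q : F[X]} (hmem : p • (1 : W.CoordinateRing) + q • Affine.CoordinateRing.mk W Y ∈
      Affine.CoordinateRing.XYIdeal W x (C y)) :
    p.eval x + q.eval x * y = 0 := by
  let φ : W.CoordinateRing →+* F := AdjoinRoot.lift (evalRingHom x) y (by
    simpa [Affine.Equation, evalEval, eval₂_evalRingHom] using h)
  have hle : Affine.CoordinateRing.XYIdeal W x (C y) ≤ RingHom.ker φ := by
    rw [Affine.CoordinateRing.XYIdeal, Ideal.span_le]
    rintro z (rfl | rfl)
    · simp [φ, Affine.CoordinateRing.XClass, RingHom.mem_ker]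
    · simp [φ, Affine.CoordinateRing.YClass, RingHom.mem_ker]
  have := hle hmem
  rw [RingHom.mem_ker, Affine.CoordinateRing.smul, Affine.CoordinateRing.smul] at this
  simpa [φ] using this

theorem norm_XClass {s t : F} (x : F) :
    Algebra.norm F[X] (Affine.CoordinateRing.XClass (shortWeierstrass s t).toAffine x) =
      (X - C x) ^ 2 := by
  have := norm_shortWeierstrass s t (X - C x) 0
  rw [zero_smul, add_zero, Affine.CoordinateRing.smul, mul_one] at this
  rw [Affine.CoordinateRing.XClass, this]
  ring

theorem exists_prod_XYIdeal_eq_span [DecidableEq F] {W : Affine F} {ι : Type*} (A : Finset ι)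
    (x y : ι → F) (h : ∀ i, W.Nonsingular (x i) (y i))
    (hsum : ∑ i ∈ A, Affine.Point.some (x i) (y i) (h i) = 0) :
    ∃ f : W.CoordinateRing, f ≠ 0 ∧
      ∏ i ∈ A, Affine.CoordinateRing.XYIdeal W (x i) (C (y i)) = Ideal.span {f} := by
  have hcl := congrArg (fun P => (Affine.Point.toClass P).toMul) hsum
  simp only [map_sum, Affine.Point.toClass_some, map_zero, toMul_zero] at hcl
  have hcl' : ClassGroup.mk W.FunctionField
      (∏ i ∈ A, Affine.CoordinateRing.XYIdeal' (W := W) (h i)) = 1 := by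
    rw [map_prod]; exact hcl
  refine (ClassGroup.mk_eq_one_of_coe_ideal ?_).1 hcl'
  rw [Units.coe_prod]
  simp only [Affine.CoordinateRing.XYIdeal'_eq]
  exact (map_prod (FractionalIdeal.coeIdealHom _ W.FunctionField) _ A).symm

theorem exists_mem_XYIdeal_of_sum_eq_zero [DecidableEq F] {W : Affine F} {ι : Type*} [Fintype ι]
    (x y : ι → F) (h : ∀ i, W.Nonsingular (x i) (y i))
    (hsum : ∑ i, Affine.Point.some (x i) (y i) (h i) = 0) :
    ∃ f g : W.CoordinateRing, f ≠ 0 ∧ g ≠ 0 ∧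
      (∀ i, f ∈ Affine.CoordinateRing.XYIdeal W (x i) (C (y i))) ∧
      (∀ i, g ∈ Affine.CoordinateRing.XYIdeal W (x i) (C (W.negY (x i) (y i)))) ∧
      Associated (g * f) (∏ i, Affine.CoordinateRing.XClass W (x i)) := by
  have hneg : ∀ i, W.Nonsingular (x i) (W.negY (x i) (y i)) :=
    fun i => (Affine.nonsingular_neg ..).2 (h i)
  have hsum' : ∑ i, Affine.Point.some (x i) (W.negY (x i) (y i)) (hneg i) = 0 := by
    rw [← neg_eq_zero, ← hsum, ← Finset.sum_neg_distrib]
    refine Finset.sum_congr rfl fun i _ => ?_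
    rw [Affine.Point.neg_some]
    simp only [Affine.negY_negY]
  obtain ⟨f, hf0, hf⟩ := exists_prod_XYIdeal_eq_span Finset.univ x y h hsum
  obtain ⟨g, hg0, hg⟩ := exists_prod_XYIdeal_eq_span Finset.univ x
    (fun i => W.negY (x i) (y i)) hneg hsum'
  refine ⟨f, g, hf0, hg0, fun i => ?_, fun i => ?_, ?_⟩
  · have hmem := Ideal.mem_span_singleton_self f
    rw [← hf] at hmem
    exact Ideal.le_of_dvd (Finset.dvd_prod_of_mem _ (Finset.mem_univ i)) hmem
  · have hmem := Ideal.mem_span_singleton_self g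
    rw [← hg] at hmem
    exact Ideal.le_of_dvd (Finset.dvd_prod_of_mem
      (fun i => Affine.CoordinateRing.XYIdeal W (x i) (C (W.negY (x i) (y i))))
      (Finset.mem_univ i)) hmem
  · rw [← Ideal.span_singleton_eq_span_singleton, ← Ideal.span_singleton_mul_span_singleton,
      ← hf, ← hg, ← Finset.prod_mul_distrib, ← Ideal.prod_span_singleton]
    exact Finset.prod_congr rfl fun i _ => Affine.CoordinateRing.XYIdeal_neg_mul (h i)

theorem natDegree_norm_of_associated {s t : F} {ι : Type*} [Fintype ι] (x : ι → F)
    {f : (shortWeierstrass s t).toAffine.CoordinateRing}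
    (hf : Associated f
      (∏ i, Affine.CoordinateRing.XClass (shortWeierstrass s t).toAffine (x i))) :
    (Algebra.norm F[X] f).natDegree = 2 * Fintype.card ι := by
  have hdeg := natDegree_eq_of_degree_eq (degree_eq_degree_of_associated
    (hf.map (Algebra.norm F[X])))
  rw [hdeg, map_prod]
  simp only [norm_XClass]
  rw [Finset.prod_pow, natDegree_pow, natDegree_finsetProd_X_sub_C_eq_card, Finset.card_univ]

theorem exists_natDegree_norm_eq_card [DecidableEq F] {s t : F} (A : Finset (F × F))
    (h : ∀ P : A, (shortWeierstrass s t).toAffine.Nonsingular P.1.1 P.1.2)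
    (hsum : ∑ P : A, Affine.Point.some P.1.1 P.1.2 (h P) = 0) :
    ∃ p q : F[X], p ^ 2 - q ^ 2 * (X ^ 3 + C s * X + C t) ≠ 0 ∧
      (p ^ 2 - q ^ 2 * (X ^ 3 + C s * X + C t)).natDegree = A.card ∧
      ∀ P ∈ A, p.eval P.1 + q.eval P.1 * P.2 = 0 := by
  obtain ⟨f, g, hf0, hg0, hf, hg, hfg⟩ := exists_mem_XYIdeal_of_sum_eq_zero
    (fun P : A => P.1.1) (fun P : A => P.1.2) h hsum
  have hdeg := natDegree_norm_of_associated _ hfg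
  have hNf := (Algebra.norm_ne_zero_iff_of_basis (Affine.CoordinateRing.basis _)).2 hf0
  have hNg := (Algebra.norm_ne_zero_iff_of_basis (Affine.CoordinateRing.basis _)).2 hg0
  rw [map_mul, natDegree_mul hNg hNf, Fintype.card_coe] at hdeg
  obtain ⟨p, q, rfl⟩ := Affine.CoordinateRing.exists_smul_basis_eq f
  obtain ⟨p', q', rfl⟩ := Affine.CoordinateRing.exists_smul_basis_eq g
  rw [norm_shortWeierstrass] at hNf hNg
  rw [norm_shortWeierstrass, norm_shortWeierstrass] at hdeg
  have hzf : ∀ P ∈ A, p.eval P.1 + q.eval P.1 * P.2 = 0 := fun P hP =>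
    eval_add_eval_mul_eq_zero_of_mem_XYIdeal (h ⟨P, hP⟩).1 (hf ⟨P, hP⟩)
  have hzg : ∀ P ∈ A, p'.eval P.1 + (-q').eval P.1 * P.2 = 0 := by
    intro P hP
    have hz := eval_add_eval_mul_eq_zero_of_mem_XYIdeal
      ((Affine.equation_neg ..).2 (h ⟨P, hP⟩).1) (hg ⟨P, hP⟩)
    simpa [Affine.negY, shortWeierstrass] using hz
  have hcurve : ∀ P ∈ A, onCurve s t P := fun P hP =>
    equation_shortWeierstrass_iff.1 (h ⟨P, hP⟩).1
  have hcf := card_le_natDegree_of_zeros hNf A fun P hP => ⟨hcurve P hP, hzf P hP⟩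
  have hcg := card_le_natDegree_of_zeros (p := p') (q := -q') (by rwa [neg_sq]) A
    fun P hP => ⟨hcurve P hP, hzg P hP⟩
  rw [neg_sq] at hcg
  exact ⟨p, q, hNf, by omega, hzf⟩

theorem card_point_le [Fintype F] [DecidableEq F] (W : Affine F) [Fintype W.Point] :
    Fintype.card W.Point ≤ 2 * Fintype.card F + 1 := by
  have h : (Finset.univ.erase (0 : W.Point)).card ≤
      2 * (Finset.univ.image fun x : F => ![x, 1]).card := by
    refine Finset.card_le_mul_card_image_of_maps_to (f := Affine.Point.xRep) ?_ 2 ?_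
    · rintro (_ | ⟨x, y, h⟩) hP
      · exact absurd rfl (Finset.mem_erase.1 hP).1
      · simp
    · intro b _
      rcases Finset.eq_empty_or_nonempty
        ((Finset.univ.erase (0 : W.Point)).filter fun P => P.xRep = b) with h0 | ⟨P, hP⟩
      · simp [h0]
      · refine (Finset.card_le_card (t := {P, -P}) fun Q hQ => ?_).trans Finset.card_le_two
        have := Affine.Point.eq_or_eq_neg_of_xRep_eq_xRep
          ((Finset.mem_filter.1 hQ).2.trans (Finset.mem_filter.1 hP).2.symm)
        simpa using this
  have h' : (Finset.univ.image fun x : F => ![x, 1]).card ≤ Fintype.card F :=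
    Finset.card_image_le
  rw [Finset.card_erase_of_mem (Finset.mem_univ _), Finset.card_univ] at h
  omega

theorem card_add_self_eq_le [DecidableEq F] {s t : F} (h2 : (2 : F) ≠ 0)
    [Fintype (shortWeierstrass s t).toAffine.Point] (g : (shortWeierstrass s t).toAffine.Point) :
    (Finset.univ.filter fun Q : (shortWeierstrass s t).toAffine.Point => Q + Q = g).card ≤ 4 := by
  rcases Finset.eq_empty_or_nonempty (Finset.univ.filter
    fun Q : (shortWeierstrass s t).toAffine.Point => Q + Q = g) with h0 | ⟨Q₀, hQ₀⟩
  · simp [h0]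
  have hQ₀ : Q₀ + Q₀ = g := by simpa using hQ₀
  set f : F[X] := C 1 * X ^ 3 + C 0 * X ^ 2 + C s * X + C t with hf
  have hf0 : f.natDegree = 3 := natDegree_cubic one_ne_zero
  have hfne : f ≠ 0 := ne_zero_of_natDegree_gt (n := 0) (by omega)
  have hroots : (insert ![1, 0] (f.roots.toFinset.image fun x : F => ![x, 1])).card ≤ 4 := by
    refine (Finset.card_insert_le _ _).trans ?_
    have h1 : (f.roots.toFinset.image fun x : F => ![x, 1]).card ≤ f.roots.toFinset.card :=
      Finset.card_image_le
    have h3 := f.roots.toFinset_card_le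
    have h4 := f.card_roots'
    omega
  refine le_trans (Finset.card_le_card_of_injOn (fun Q => (Q - Q₀).xRep) ?_ ?_) hroots
  · intro Q hQ
    have hQ : Q + Q = g := by simpa using hQ
    have hR : (Q - Q₀) = -(Q - Q₀) := by
      rw [eq_neg_iff_add_eq_zero, sub_add_sub_comm, hQ, hQ₀, sub_self]
    show (Q - Q₀).xRep ∈ _
    generalize Q - Q₀ = R at hR
    rcases R with _ | ⟨x, y, h⟩
    · exact Finset.mem_insert_self _ _
    · rw [Affine.Point.neg_some, Affine.Point.some.injEq] at hR
      have hy : y = -y := by simpa [Affine.negY, shortWeierstrass] using hR.2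
      have hy0 : y = 0 := (mul_eq_zero.1 (show 2 * y = 0 by linear_combination hy)).resolve_left h2
      have hc := (equation_shortWeierstrass_iff (P := (x, y))).1 h.1
      simp only [onCurve] at hc
      refine Finset.mem_coe.2 (Finset.mem_insert_of_mem (Finset.mem_image.2 ⟨x, ?_, by simp⟩))
      rw [Multiset.mem_toFinset, mem_roots hfne]
      simp only [hf, IsRoot, eval_add, eval_mul, eval_pow, eval_X, eval_C]
      rw [hy0] at hc
      linear_combination -hc
  · intro Q hQ Q' hQ' hQQ
    have hQ : Q + Q = g := by simpa using hQ
    have hQ' : Q' + Q' = g := by simpa using hQ'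
    rcases Affine.Point.eq_or_eq_neg_of_xRep_eq_xRep hQQ with h | h
    · exact sub_left_injective h
    · have hR : Q' - Q₀ = -(Q' - Q₀) := by
        rw [eq_neg_iff_add_eq_zero, sub_add_sub_comm, hQ', hQ₀, sub_self]
      exact sub_left_injective (h.trans hR.symm)

/-- The `x`-part `p` of the function `p(x) + q(x) y` with coordinate vector `u`. -/
noncomputable def polyOne {k : ℕ} (u : Fin k → F) : F[X] :=
  ∑ j : Fin k, if (j : ℕ) ≤ k / 2 then monomial (j : ℕ) (u j) else 0

/-- The `y`-part `q` of the function `p(x) + q(x) y` with coordinate vector `u`. -/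
noncomputable def polyY {k : ℕ} (u : Fin k → F) : F[X] :=
  ∑ j : Fin k, if (j : ℕ) ≤ k / 2 then 0 else monomial ((j : ℕ) - k / 2 - 1) (u j)

theorem vecMul_Hmat {n k : ℕ} (P : Fin n → F × F) (u : Fin k → F) (i : Fin n) :
    Matrix.vecMul u (Hmat k P) i =
      (polyOne u).eval (P i).1 + (polyY u).eval (P i).1 * (P i).2 := by
  simp only [Matrix.vecMul, dotProduct, Hmat, phiAff, polyOne, polyY, eval_finsetSum,
    Finset.sum_mul, ← Finset.sum_add_distrib]
  refine Finset.sum_congr rfl fun j _ => ?_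
  split_ifs
  · simp
  · simp; ring

theorem coeff_polyOne {k : ℕ} (u : Fin k → F) (j : Fin k) (hj : (j : ℕ) ≤ k / 2) :
    (polyOne u).coeff j = u j := by
  rw [polyOne, finsetSum_coeff, Finset.sum_eq_single j]
  · simp [hj]
  · intro b _ hb
    have : (b : ℕ) ≠ j := fun h => hb (Fin.ext h)
    split_ifs <;> simp [coeff_monomial, this]
  · simp

theorem coeff_polyY {k : ℕ} (u : Fin k → F) (j : Fin k) (hj : k / 2 < (j : ℕ)) :
    (polyY u).coeff ((j : ℕ) - k / 2 - 1) = u j := by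
  rw [polyY, finsetSum_coeff, Finset.sum_eq_single j]
  · simp [hj.not_ge]
  · intro b _ hb
    split_ifs with h
    · simp
    · have : (b : ℕ) - k / 2 - 1 ≠ (j : ℕ) - k / 2 - 1 := fun h => hb (Fin.ext (by omega))
      simp [coeff_monomial, this]
  · simp

theorem coeff_polyOne_eq_zero {k m : ℕ} (u : Fin k → F) (hm : k / 2 < m) :
    (polyOne u).coeff m = 0 := by
  rw [polyOne, finsetSum_coeff]
  refine Finset.sum_eq_zero fun j _ => ?_
  split_ifs with h
  · rw [coeff_monomial, if_neg (by omega)]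
  · simp

theorem coeff_polyY_eq_zero {k m : ℕ} (u : Fin k → F) (hm : k < 2 * m + 3) :
    (polyY u).coeff m = 0 := by
  rw [polyY, finsetSum_coeff]
  refine Finset.sum_eq_zero fun j _ => ?_
  split_ifs with h
  · simp
  · rw [coeff_monomial, if_neg (by omega)]

theorem natDegree_norm_poly_le {k : ℕ} (s t : F) (u : Fin k → F) :
    (polyOne u ^ 2 - polyY u ^ 2 * (X ^ 3 + C s * X + C t)).natDegree ≤ k := by
  have hp : (polyOne u).natDegree ≤ k / 2 :=
    natDegree_le_iff_coeff_eq_zero.2 fun m hm => coeff_polyOne_eq_zero u hm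
  refine (natDegree_sub_le _ _).trans (max_le ?_ ?_)
  · exact natDegree_pow_le.trans (by omega)
  · by_cases hk : k < 3
    · have : polyY u = 0 := by
        ext m
        rw [coeff_polyY_eq_zero u (by omega), coeff_zero]
      simp [this]
    · have hq : (polyY u).natDegree ≤ (k - 3) / 2 :=
        natDegree_le_iff_coeff_eq_zero.2 fun m hm => coeff_polyY_eq_zero u (by omega)
      have hf : (X ^ 3 + C s * X + C t : F[X]).natDegree ≤ 3 := by compute_degree
      have h2 : (polyY u ^ 2).natDegree ≤ 2 * (polyY u).natDegree := natDegree_pow_le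
      exact natDegree_mul_le.trans (by omega)

theorem eq_zero_of_norm_eq_zero {s t : F} {p q : F[X]}
    (h : p ^ 2 - q ^ 2 * (X ^ 3 + C s * X + C t) = 0) : p = 0 ∧ q = 0 := by
  rw [← norm_shortWeierstrass,
    Algebra.norm_eq_zero_iff_of_basis (Affine.CoordinateRing.basis _)] at h
  exact Affine.CoordinateRing.smul_basis_eq_zero h

theorem norm_poly_ne_zero {k : ℕ} (s t : F) {u : Fin k → F} (hu : u ≠ 0) :
    polyOne u ^ 2 - polyY u ^ 2 * (X ^ 3 + C s * X + C t) ≠ 0 := by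
  intro h
  obtain ⟨hp, hq⟩ := eq_zero_of_norm_eq_zero h
  refine hu (funext fun j => ?_)
  rcases le_or_gt (j : ℕ) (k / 2) with hj | hj
  · rw [← coeff_polyOne u j hj, hp, coeff_zero, Pi.zero_apply]
  · rw [← coeff_polyY u j hj, hq, coeff_zero, Pi.zero_apply]

theorem exists_polyOne_polyY_eq {k : ℕ} (hk : 2 ≤ k) {s t : F} {p q : F[X]}
    (hdeg : (p ^ 2 - q ^ 2 * (X ^ 3 + C s * X + C t)).natDegree ≤ k) :
    ∃ u : Fin k → F, polyOne u = p ∧ polyY u = q := by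
  have hd := degree_le_of_natDegree_le hdeg
  rw [← norm_shortWeierstrass, Affine.CoordinateRing.degree_norm_smul_basis, max_le_iff] at hd
  obtain ⟨hdp, hdq⟩ := hd
  have hp : ∀ m, k / 2 < m → p.coeff m = 0 := by
    intro m hm
    by_contra h
    have h1 := le_degree_of_ne_zero h
    have h3 : ((2 * m : ℕ) : WithBot ℕ) ≤ k := by
      refine le_trans ?_ hdp
      push_cast
      rw [two_mul, two_nsmul]
      exact add_le_add h1 h1
    have := Nat.cast_le.1 h3
    omega
  have hq : ∀ m, k < 2 * m + 3 → q.coeff m = 0 := by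
    intro m hm
    by_contra h
    have h1 := le_degree_of_ne_zero h
    have h3 : ((2 * m + 3 : ℕ) : WithBot ℕ) ≤ k := by
      refine le_trans ?_ hdq
      push_cast
      rw [two_mul, two_nsmul]
      exact add_le_add (add_le_add h1 h1) le_rfl
    have := Nat.cast_le.1 h3
    omega
  set u : Fin k → F := fun j =>
    if (j : ℕ) ≤ k / 2 then p.coeff j else q.coeff ((j : ℕ) - k / 2 - 1) with hu
  refine ⟨u, ?_, ?_⟩
  · ext m
    rcases le_or_gt m (k / 2) with hm | hm
    · have := coeff_polyOne u ⟨m, by omega⟩ hm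
      simpa [hu, hm] using this
    · rw [coeff_polyOne_eq_zero u hm, hp m hm]
  · ext m
    rcases lt_or_ge k (2 * m + 3) with hm | hm
    · rw [coeff_polyY_eq_zero u hm, hq m hm]
    · have := coeff_polyY u ⟨m + k / 2 + 1, by omega⟩
        (show k / 2 < m + k / 2 + 1 by omega)
      have h1 : m + k / 2 + 1 - k / 2 - 1 = m := by omega
      have h2 : ¬ m + k / 2 + 1 ≤ k / 2 := by omega
      simpa only [hu, h1, h2, if_false] using this

theorem hammingDist_zero_add_card_zeros [DecidableEq F] {n : ℕ} (c : Fin n → F) :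
    hammingDist c 0 + (Finset.univ.filter fun i => c i = 0).card = n := by
  have := Finset.card_filter_add_card_filter_not (s := (Finset.univ : Finset (Fin n)))
    fun i => c i = 0
  rw [Finset.card_univ, Fintype.card_fin] at this
  rw [add_comm]
  simpa [hammingDist] using this

theorem le_hammingDist_vecMul [DecidableEq F] {n k : ℕ} {s t : F} {P : Fin n → F × F}
    (hPinj : Function.Injective P) (hPcurve : ∀ i, onCurve s t (P i)) {u : Fin k → F}
    (hu : u ≠ 0) : n - k ≤ hammingDist (Matrix.vecMul u (Hmat k P)) 0 := by
  have h := hammingDist_zero_add_card_zeros (Matrix.vecMul u (Hmat k P))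
  set Z := Finset.univ.filter fun i => Matrix.vecMul u (Hmat k P) i = 0 with hZ
  have hcard : Z.card ≤ k := by
    rw [← Finset.card_image_of_injective Z hPinj]
    refine (card_le_natDegree_of_zeros (norm_poly_ne_zero s t hu) _ ?_).trans
      (natDegree_norm_poly_le s t u)
    intro Q hQ
    obtain ⟨i, hi, rfl⟩ := Finset.mem_image.1 hQ
    refine ⟨hPcurve i, ?_⟩
    rw [← vecMul_Hmat]
    exact (Finset.mem_filter.1 hi).2
  omega

end EllipticCodes

/-- If `n ≥ q+3`, `2 ≤ k ≤ n−2` and moreover `n ≥ q+k`, or `q` is prime,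
or `k ≤ √q` (i.e. `k·k ≤ q`), then the functional elliptic code `C_L(D, kO)` has
minimum distance exactly `n − k`. -/
theorem min_dist_of_long_functional_elliptic_code
    (F : Type) [Field F] [Fintype F] [DecidableEq F]
    (hq : Odd (Fintype.card F))
    (s t : F) (hdisc : 4 * s ^ 3 + 27 * t ^ 2 ≠ 0)
    {n : ℕ} (k : ℕ) (P : Fin n → F × F)
    (hPinj : Function.Injective P)
    (hPcurve : ∀ i, onCurve s t (P i))
    (hk2 : 2 ≤ k) (hkn : k ≤ n - 2)
    (hn : Fintype.card F + 3 ≤ n)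
    (hcond : Fintype.card F + k ≤ n ∨ (Fintype.card F).Prime ∨ k * k ≤ Fintype.card F) :
    minDist (funcCode k P) = n - k := by
  classical
  have h2 : (2 : F) ≠ 0 := by
    refine Ring.two_ne_zero fun h => ?_
    have := FiniteField.even_card_of_char_two h
    have := Nat.odd_iff.1 hq
    omega
  have hlow : ∀ u : Fin k → F, u ≠ 0 → n - k ≤ hammingDist (Matrix.vecMul u (Hmat k P)) 0 :=
    fun u hu => le_hammingDist_vecMul hPinj hPcurve hu
  have : Finite (shortWeierstrass s t).toAffine.Point := by
    have : Finite (WithZero {xy : F × F //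
        (shortWeierstrass s t).toAffine.Nonsingular xy.fst xy.snd}) :=
      inferInstanceAs (Finite (Option _))
    exact Finite.of_equiv _ (WeierstrassCurve.Affine.nonsingularPointEquiv _).symm
  have := Fintype.ofFinite (shortWeierstrass s t).toAffine.Point
  have hns : ∀ i, (shortWeierstrass s t).toAffine.Nonsingular (P i).1 (P i).2 :=
    fun i => nonsingular_shortWeierstrass h2 hdisc (hPcurve i)
  let pt : Fin n → (shortWeierstrass s t).toAffine.Point :=
    fun i => .some (P i).1 (P i).2 (hns i)
  have hpt : Function.Injective pt := by
    intro i j hij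
    have := (WeierstrassCurve.Affine.Point.some.injEq ..).mp hij
    exact hPinj (Prod.ext this.1 this.2)
  have hD : (Finset.univ.image pt).card = n := by
    rw [Finset.card_image_of_injective _ hpt, Finset.card_univ, Fintype.card_fin]
  have hN := card_point_le (shortWeierstrass s t).toAffine
  obtain ⟨B, hB, hBk, hBs⟩ := exists_subset_sum_eq (D := Finset.univ.image pt)
    (card_add_self_eq_le h2) (by omega) hk2 (by omega) 0
  obtain ⟨I, -, rfl⟩ := Finset.subset_image_iff.1 hB
  rw [Finset.card_image_of_injective _ hpt] at hBk
  rw [Finset.sum_image hpt.injOn] at hBs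
  obtain ⟨p, q, hne, hdeg, hz⟩ := exists_natDegree_norm_eq_card (s := s) (t := t) (I.image P)
    (fun Q => by
      obtain ⟨i, -, hi⟩ := Finset.mem_image.1 Q.2
      rw [← hi]; exact hns i) (by
      rw [← hBs]
      refine (Finset.sum_bij (fun i hi => ⟨P i, Finset.mem_image_of_mem P hi⟩) ?_ ?_ ?_ ?_).symm
      · intros; exact Finset.mem_univ _
      · intro i _ j _ hij
        exact hPinj (Subtype.ext_iff.1 hij)
      · rintro ⟨Q, hQ⟩ _
        obtain ⟨i, hi, rfl⟩ := Finset.mem_image.1 hQ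
        exact ⟨i, hi, rfl⟩
      · intros; rfl)
  rw [Finset.card_image_of_injective _ hPinj, hBk] at hdeg
  obtain ⟨u, rfl, rfl⟩ := exists_polyOne_polyY_eq hk2 hdeg.le
  have hu : u ≠ 0 := by
    rintro rfl
    exact hne (by simp [polyOne, polyY])
  set c := Matrix.vecMul u (Hmat k P) with hc
  have hcn : hammingDist c 0 = n - k := by
    have h1 : n - k ≤ hammingDist c 0 := hlow u hu
    have h3 := hammingDist_zero_add_card_zeros c
    have h4 : I.card ≤ (Finset.univ.filter fun i => c i = 0).card := by
      refine Finset.card_le_card fun i hi => ?_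
      rw [Finset.mem_filter, hc, vecMul_Hmat]
      exact ⟨Finset.mem_univ _, hz _ (Finset.mem_image_of_mem P hi)⟩
    omega
  have hmem : n - k ∈ (fun c => hammingDist c 0) '' (funcCode k P \ {0}) := by
    refine ⟨c, ⟨⟨u, hc⟩, fun h0 => ?_⟩, hcn⟩
    rw [Set.mem_singleton_iff.1 h0, hammingDist_self] at hcn
    omega
  refine le_antisymm (Nat.sInf_le hmem) (le_csInf ⟨_, hmem⟩ ?_)
  rintro _ ⟨_, ⟨⟨v, rfl⟩, hv⟩, rfl⟩
  exact hlow v fun h => hv (by simp [h])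
end

section
/- Let 2 ≤ k ≤ n−2 and suppose the residue elliptic code C = C_Ω(D,kO) has covering radius k−1. Let P = (α,β) be an affine rational point of E with P ∉ D. Then every word v ∈ F_q^n whose syndrome satisfies H(k)vᵀ = c·φ_k(P) for some nonzero c ∈ F_q (equivalently, every v ∈ C_Ω(D,kO−P) ∖ C, where C_Ω(D,kO−P) = {v ∈ F_q^n : H(k)vᵀ ∈ F_q·φ_k(P)}) is a deep hole of C. -/
open Matrix BigOperators

open Polynomial in
/-- A function `a + y b` on `y² = x³ + s x + t` has nonzero norm unless `a = b = 0`. -/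
lemma curveNorm_ne_zero {F : Type*} [Field F] (s t : F) {a b : F[X]}
    (h : a ≠ 0 ∨ b ≠ 0) : a ^ 2 - b ^ 2 * (X ^ 3 + C s * X + C t) ≠ 0 := by
  intro h0
  have hW : (X ^ 3 + C s * X + C t : F[X]).natDegree = 3 := by compute_degree!
  have hW0 : (X ^ 3 + C s * X + C t : F[X]) ≠ 0 := by
    intro hz
    simp [hz] at hW
  have hab : a ^ 2 = b ^ 2 * (X ^ 3 + C s * X + C t) := sub_eq_zero.mp h0
  by_cases hb : b = 0
  · subst hb
    simp_all
  · have hdeg := congrArg natDegree hab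
    rw [natDegree_mul (pow_ne_zero 2 hb) hW0, hW, natDegree_pow, natDegree_pow] at hdeg
    omega

open Polynomial in
lemma natDegree_eq_zero_of_monic_mul_le {F : Type*} [Field F] {R e : F[X]} (hR : R.Monic)
    (h : (R * e).natDegree ≤ R.natDegree) : e.natDegree = 0 := by
  by_cases he : e = 0
  · simp [he]
  · rw [hR.natDegree_mul' he] at h
    omega

open Polynomial in
/-- If `a + y b` has pole order at most `|T|`, `c + y d` has pole order at most `|T| + 1`, and both
vanish on a set `T` of curve points with distinct `x`-coordinates, then they are proportional. -/
lemma proportional_of_vanish_of_injOn {F : Type*} [Field F] (s t : F)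
    (T : Finset (F × F)) (hT : ∀ p ∈ T, onCurve s t p)
    (hinj : Set.InjOn Prod.fst (T : Set (F × F)))
    (a b c d : F[X]) (hab : a ≠ 0 ∨ b ≠ 0)
    (ha : 2 * a.natDegree ≤ T.card) (hb : b ≠ 0 → 2 * b.natDegree + 3 ≤ T.card)
    (hc : 2 * c.natDegree ≤ T.card + 1) (hd : d ≠ 0 → 2 * d.natDegree + 3 ≤ T.card + 1)
    (hf : ∀ p ∈ T, a.eval p.1 + p.2 * b.eval p.1 = 0)
    (hg : ∀ p ∈ T, c.eval p.1 + p.2 * d.eval p.1 = 0) :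
    ∃ r : F, c = C r * a ∧ d = C r * b := by
  set W : F[X] := X ^ 3 + C s * X + C t with hWdef
  have hW : W.natDegree = 3 := by rw [hWdef]; compute_degree!
  have hWeval : ∀ p ∈ T, W.eval p.1 = p.2 ^ 2 := by
    intro p hp
    rw [hT p hp, hWdef]
    simp
  set R : F[X] := ∏ p ∈ T, (X - C p.1) with hRdef
  have hRm : R.Monic := monic_prod_of_monic _ _ fun p _ => monic_X_sub_C _
  have hRd : R.natDegree = T.card := by
    rw [hRdef, natDegree_prod_of_monic _ _ fun p _ => monic_X_sub_C _]
    simp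
  have hRdvd : ∀ f : F[X], (∀ p ∈ T, f.eval p.1 = 0) → R ∣ f := by
    intro f hf0
    refine Finset.prod_dvd_of_coprime ?_ fun p hp => dvd_iff_isRoot.mpr (hf0 p hp)
    intro p hp p' hp' hne
    exact isCoprime_X_sub_C_of_isUnit_sub
      (sub_ne_zero.mpr fun h => hne (hinj hp hp' h)).isUnit
  have hWmul : ∀ f g : F[X], (f ≠ 0 → g ≠ 0 → f.natDegree + g.natDegree + 3 ≤ T.card) →
      (f * g * W).natDegree ≤ T.card := by
    intro f g h
    by_cases hf0 : f = 0
    · simp [hf0]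
    by_cases hg0 : g = 0
    · simp [hg0]
    have h1 := natDegree_mul_le (p := f * g) (q := W)
    have h2 := natDegree_mul_le (p := f) (q := g)
    have h3 := h hf0 hg0
    omega
  have hdet : a * d = b * c := by
    rw [← sub_eq_zero]
    refine eq_zero_of_dvd_of_degree_lt (hRdvd _ ?_) ?_
    · intro p hp
      have h1 := hf p hp
      have h2 := hg p hp
      simp only [eval_sub, eval_mul]
      linear_combination d.eval p.1 * h1 - b.eval p.1 * h2
    · rw [degree_eq_natDegree hRm.ne_zero, hRd]
      refine lt_of_le_of_lt (degree_sub_le _ _) (max_lt ?_ ?_)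
      · by_cases hd0 : d = 0
        · simp [hd0]
        · have := hd hd0
          refine lt_of_le_of_lt (degree_le_natDegree) ?_
          have := natDegree_mul_le (p := a) (q := d)
          exact_mod_cast (by omega : (a * d).natDegree < T.card)
      · by_cases hb0 : b = 0
        · simp [hb0]
        · have := hb hb0
          refine lt_of_le_of_lt (degree_le_natDegree) ?_
          have := natDegree_mul_le (p := b) (q := c)
          exact_mod_cast (by omega : (b * c).natDegree < T.card)
  obtain ⟨m, hm⟩ : R ∣ a ^ 2 - b ^ 2 * W := by
    refine hRdvd _ fun p hp => ?_
    have h1 := hf p hp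
    simp only [eval_sub, eval_mul, eval_pow, hWeval p hp]
    linear_combination (a.eval p.1 - p.2 * b.eval p.1) * h1
  obtain ⟨e, he⟩ : R ∣ a * c - b * d * W := by
    refine hRdvd _ fun p hp => ?_
    have h1 := hf p hp
    have h2 := hg p hp
    simp only [eval_sub, eval_mul, hWeval p hp]
    linear_combination c.eval p.1 * h1 - p.2 * b.eval p.1 * h2
  have hm0 : m ≠ 0 := by
    rintro rfl
    exact curveNorm_ne_zero s t hab (by rw [hm, mul_zero])
  have hmd : m.natDegree = 0 := by
    refine natDegree_eq_zero_of_monic_mul_le hRm ?_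
    rw [← hm, hRd]
    refine (natDegree_sub_le _ _).trans (max_le ?_ ?_)
    · rw [natDegree_pow]
      exact ha
    · rw [pow_two]
      refine hWmul _ _ fun hb0 _ => ?_
      have := hb hb0
      omega
  have hed : e.natDegree = 0 := by
    refine natDegree_eq_zero_of_monic_mul_le hRm ?_
    rw [← he, hRd]
    refine (natDegree_sub_le _ _).trans (max_le ?_ ?_)
    · have := natDegree_mul_le (p := a) (q := c)
      omega
    · refine hWmul _ _ fun hb0 hd0 => ?_
      have := hb hb0
      have := hd hd0
      omega
  obtain ⟨m₀, rfl⟩ := natDegree_eq_zero.mp hmd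
  obtain ⟨e₀, rfl⟩ := natDegree_eq_zero.mp hed
  have hm₀ : m₀ ≠ 0 := by
    rintro rfl
    simp at hm0
  have hmm : C m₀⁻¹ * C m₀ = (1 : F[X]) := by
    rw [← C_mul, inv_mul_cancel₀ hm₀, C_1]
  have hca : C m₀ * c = C e₀ * a := by
    refine mul_left_cancel₀ hRm.ne_zero ?_
    linear_combination (-c) * hm + a * he + b * W * hdet
  have hdb : C m₀ * d = C e₀ * b := by
    refine mul_left_cancel₀ hRm.ne_zero ?_
    linear_combination (-d) * hm + b * he + a * hdet
  refine ⟨m₀⁻¹ * e₀, ?_, ?_⟩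
  · rw [C_mul]
    linear_combination C m₀⁻¹ * hca - c * hmm
  · rw [C_mul]
    linear_combination C m₀⁻¹ * hdb - d * hmm

open Polynomial in
/-- If `a + y b` has pole order at most `|T|`, `c + y d` has pole order at most `|T| + 1`, and both
vanish on a set `T` of curve points, then they are proportional. -/
lemma proportional_of_vanish {F : Type*} [Field F] (s t : F)
    (T : Finset (F × F)) (hT : ∀ p ∈ T, onCurve s t p)
    (a b c d : F[X]) (hab : a ≠ 0 ∨ b ≠ 0)
    (ha : 2 * a.natDegree ≤ T.card) (hb : b ≠ 0 → 2 * b.natDegree + 3 ≤ T.card)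
    (hc : 2 * c.natDegree ≤ T.card + 1) (hd : d ≠ 0 → 2 * d.natDegree + 3 ≤ T.card + 1)
    (hf : ∀ p ∈ T, a.eval p.1 + p.2 * b.eval p.1 = 0)
    (hg : ∀ p ∈ T, c.eval p.1 + p.2 * d.eval p.1 = 0) :
    ∃ r : F, c = C r * a ∧ d = C r * b := by
  classical
  induction hN : T.card using Nat.strong_induction_on generalizing T a b c d with
  | _ N ih =>
  by_cases hinj : Set.InjOn Prod.fst (T : Set (F × F))
  · exact proportional_of_vanish_of_injOn s t T hT hinj a b c d hab ha hb hc hd hf hg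
  simp only [Set.InjOn, not_forall] at hinj
  obtain ⟨p, hp, p', hp', hx, hne⟩ := hinj
  have hp : p ∈ T := hp
  have hp' : p' ∈ T := hp'
  have hy : p.2 - p'.2 ≠ 0 := fun h => hne (Prod.ext hx (sub_eq_zero.mp h))
  have hroots : ∀ f g : F[X], (∀ q ∈ T, f.eval q.1 + q.2 * g.eval q.1 = 0) →
      (X - C p.1) ∣ f ∧ (X - C p.1) ∣ g := by
    intro f g h
    have h1 := h p hp
    have h2 := h p' hp'
    rw [← hx] at h2
    have hg0 : g.eval p.1 = 0 := by
      refine (mul_eq_zero.mp ?_).resolve_left hy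
      linear_combination h1 - h2
    rw [hg0, mul_zero, add_zero] at h1
    exact ⟨dvd_iff_isRoot.mpr h1, dvd_iff_isRoot.mpr hg0⟩
  have hdeg : ∀ f : F[X], f ≠ 0 → ((X - C p.1) * f).natDegree = f.natDegree + 1 := by
    intro f hf0
    rw [(monic_X_sub_C p.1).natDegree_mul' hf0, natDegree_X_sub_C, add_comm]
  obtain ⟨⟨a, rfl⟩, ⟨b, rfl⟩⟩ := hroots a b hf
  obtain ⟨⟨c, rfl⟩, ⟨d, rfl⟩⟩ := hroots c d hg
  set T' := (T.erase p).erase p' with hT'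
  have hcard : T'.card + 2 = T.card := by
    have h1 := Finset.card_erase_add_one hp
    have h2 := Finset.card_erase_add_one (Finset.mem_erase.mpr ⟨Ne.symm hne, hp'⟩)
    rw [hT']
    omega
  have hsub : ∀ q ∈ T', q ∈ T := fun q hq => Finset.mem_of_mem_erase (Finset.mem_of_mem_erase hq)
  have hX : ∀ q ∈ T', q.1 - p.1 ≠ 0 := by
    intro q hq h
    have hqx : q.1 = p.1 := sub_eq_zero.mp h
    have h1 : q.2 ^ 2 = _ := hT q (hsub q hq)
    have h2 : p.2 ^ 2 = _ := hT p hp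
    have h3 : p'.2 ^ 2 = _ := hT p' hp'
    rw [hqx, ← h2] at h1
    rw [← hx, ← h2] at h3
    simp only [hT', Finset.mem_erase] at hq
    have hqp : q.2 - p.2 ≠ 0 := fun h => hq.2.1 (Prod.ext hqx (sub_eq_zero.mp h))
    have hqp' : q.2 - p'.2 ≠ 0 := fun h => hq.1 (Prod.ext (hqx.trans hx) (sub_eq_zero.mp h))
    have h4 : q.2 + p.2 = 0 := by
      refine (mul_eq_zero.mp ?_).resolve_left hqp
      linear_combination h1
    have h5 : p.2 + p'.2 = 0 := by
      refine (mul_eq_zero.mp ?_).resolve_left hy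
      linear_combination -h3
    exact hqp' (by linear_combination h4 - h5)
  have hred : ∀ f g : F[X],
      (∀ q ∈ T, ((X - C p.1) * f).eval q.1 + q.2 * ((X - C p.1) * g).eval q.1 = 0) →
      ∀ q ∈ T', f.eval q.1 + q.2 * g.eval q.1 = 0 := by
    intro f g h q hq
    have h1 := h q (hsub q hq)
    simp only [eval_mul, eval_sub, eval_X, eval_C] at h1
    refine (mul_eq_zero.mp ?_).resolve_left (hX q hq)
    linear_combination h1
  have hX0 : (X - C p.1 : F[X]) ≠ 0 := X_sub_C_ne_zero _
  obtain ⟨r, hr1, hr2⟩ := ih T'.card (by omega) T' (fun q hq => hT q (hsub q hq)) a b c d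
    (hab.imp right_ne_zero_of_mul right_ne_zero_of_mul)
    (by
      by_cases h0 : a = 0
      · simp [h0]
      · rw [hdeg a h0] at ha
        omega)
    (fun h0 => by
      have := hb (mul_ne_zero hX0 h0)
      rw [hdeg b h0] at this
      omega)
    (by
      by_cases h0 : c = 0
      · simp [h0]
      · rw [hdeg c h0] at hc
        omega)
    (fun h0 => by
      have := hd (mul_ne_zero hX0 h0)
      rw [hdeg d h0] at this
      omega)
    (hred a b hf) (hred c d hg) rfl
  exact ⟨r, by linear_combination (X - C p.1) * hr1, by linear_combination (X - C p.1) * hr2⟩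

open Polynomial in
/-- The part in `x` alone of the function with coefficient vector `u` in the monomial basis. -/
noncomputable def xPart {F : Type*} [Field F] {k : ℕ} (u : Fin k → F) : F[X] :=
  ∑ m ∈ Finset.range (k / 2 + 1), C (if h : m < k then u ⟨m, h⟩ else 0) * X ^ m

open Polynomial in
/-- The cofactor of `y` in the function with coefficient vector `u` in the monomial basis. -/
noncomputable def yPart {F : Type*} [Field F] {k : ℕ} (u : Fin k → F) : F[X] :=
  ∑ m ∈ Finset.range ((k - 1) / 2),
    C (if h : k / 2 + 1 + m < k then u ⟨k / 2 + 1 + m, h⟩ else 0) * X ^ m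

lemma coeff_xPart {F : Type*} [Field F] {k : ℕ} (u : Fin k → F) (m : ℕ) :
    (xPart u).coeff m =
      if m < k / 2 + 1 then (if h : m < k then u ⟨m, h⟩ else 0) else 0 := by
  simp [xPart, Polynomial.coeff_C_mul, Polynomial.coeff_X_pow]

lemma coeff_yPart {F : Type*} [Field F] {k : ℕ} (u : Fin k → F) (m : ℕ) :
    (yPart u).coeff m =
      if m < (k - 1) / 2 then
        (if h : k / 2 + 1 + m < k then u ⟨k / 2 + 1 + m, h⟩ else 0) else 0 := by
  simp [yPart, Polynomial.coeff_C_mul, Polynomial.coeff_X_pow]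

lemma apply_eq_coeff_xPart {F : Type*} [Field F] {k : ℕ} (u : Fin k → F) (j : Fin k)
    (hj : (j : ℕ) < k / 2 + 1) : u j = (xPart u).coeff j := by
  simp [coeff_xPart, hj]

lemma apply_eq_coeff_yPart {F : Type*} [Field F] {k : ℕ} (u : Fin k → F) (j : Fin k)
    (hj : ¬ (j : ℕ) < k / 2 + 1) : u j = (yPart u).coeff (j - (k / 2 + 1)) := by
  have h1 : (j : ℕ) - (k / 2 + 1) < (k - 1) / 2 := by omega
  have h2 : k / 2 + 1 + ((j : ℕ) - (k / 2 + 1)) = j := by omega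
  simp [coeff_yPart, h1, h2]

lemma eq_zero_of_xPart_yPart {F : Type*} [Field F] {k : ℕ} {u : Fin k → F}
    (hx : xPart u = 0) (hy : yPart u = 0) : u = 0 := by
  ext j
  by_cases hj : (j : ℕ) < k / 2 + 1
  · simp [apply_eq_coeff_xPart u j hj, hx]
  · simp [apply_eq_coeff_yPart u j hj, hy]

lemma dotProduct_phiAff {F : Type*} [Field F] {k : ℕ} (hk : 2 ≤ k) (u : Fin k → F) (p : F × F) :
    u ⬝ᵥ phiAff k p = (xPart u).eval p.1 + p.2 * (yPart u).eval p.1 := by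
  have h0 : u ⬝ᵥ phiAff k p = ∑ j ∈ Finset.range (k / 2 + 1 + (k - 1) / 2),
      (if h : j < k then u ⟨j, h⟩ else 0) *
        (if j ≤ k / 2 then p.1 ^ j else p.2 * p.1 ^ (j - k / 2 - 1)) := by
    rw [show k / 2 + 1 + (k - 1) / 2 = k by omega, Finset.sum_range]
    simp [dotProduct, phiAff]
  rw [h0, Finset.sum_range_add, xPart, yPart, Polynomial.eval_finsetSum,
    Polynomial.eval_finsetSum, Finset.mul_sum]
  congr 1
  · refine Finset.sum_congr rfl fun m hm => ?_
    rw [Finset.mem_range] at hm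
    simp [show m ≤ k / 2 by omega]
  · refine Finset.sum_congr rfl fun m hm => ?_
    rw [if_neg (by omega), show k / 2 + 1 + m - k / 2 - 1 = m by omega]
    simp only [Polynomial.eval_mul, Polynomial.eval_C, Polynomial.eval_pow, Polynomial.eval_X]
    ring

/-- Some nonzero function in `L(kO)` vanishes at `k - 2` given points and has a prescribed
coefficient equal to zero. -/
lemma exists_vanish_of_card {F : Type*} [Field F] {n k : ℕ} (P : Fin n → F × F)
    (S : Finset (Fin n)) (hS : S.card + 2 ≤ k) (j : Fin k) :
    ∃ u : Fin k → F, u ≠ 0 ∧ u j = 0 ∧ ∀ i ∈ S, u ⬝ᵥ phiAff k (P i) = 0 := by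
  let L : (Fin k → F) →ₗ[F] (S → F) × F :=
    LinearMap.prod
      { toFun := fun u i => u ⬝ᵥ phiAff k (P i)
        map_add' := fun u w => by ext i; simp
        map_smul' := fun r u => by ext i; simp }
      (LinearMap.proj j)
  have hker : LinearMap.ker L ≠ ⊥ := by
    refine LinearMap.ker_ne_bot_of_finrank_lt ?_
    simp
    omega
  obtain ⟨u, hu, hu0⟩ := Submodule.exists_mem_ne_zero_of_ne_bot hker
  rw [LinearMap.mem_ker, Prod.ext_iff] at hu
  exact ⟨u, hu0, hu.2, fun i hi => congrFun hu.1 ⟨i, hi⟩⟩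

lemma two_mul_natDegree_xPart_le {F : Type*} [Field F] {k : ℕ} (u : Fin k → F) :
    2 * (xPart u).natDegree ≤ k := by
  have : (xPart u).natDegree ≤ k / 2 := by
    rw [Polynomial.natDegree_le_iff_coeff_eq_zero]
    intro m hm
    rw [coeff_xPart, if_neg (by omega)]
  omega

lemma two_mul_natDegree_yPart_le {F : Type*} [Field F] {k : ℕ} (u : Fin k → F)
    (hu : yPart u ≠ 0) : 2 * (yPart u).natDegree + 3 ≤ k := by
  have h := Polynomial.leadingCoeff_ne_zero.mpr hu
  rw [Polynomial.leadingCoeff, coeff_yPart] at h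
  by_contra hlt
  exact h (if_neg (by omega))

/-- A function in `L(kO)` vanishing at `k - 2` affine points of the curve need not vanish at a
further one: these points impose independent conditions. -/
lemma exists_vanish_ne_zero {F : Type*} [Field F] {n k : ℕ} (s t : F) (P : Fin n → F × F)
    (hPinj : Function.Injective P) (hPcurve : ∀ i, onCurve s t (P i)) (hk : 2 ≤ k)
    (S : Finset (Fin n)) (hS : S.card + 2 = k)
    (Q : F × F) (hQ : onCurve s t Q) (hQD : Q ∉ Set.range P) :
    ∃ u : Fin k → F, (∀ i ∈ S, u ⬝ᵥ phiAff k (P i) = 0) ∧ u ⬝ᵥ phiAff k Q ≠ 0 := by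
  classical
  by_contra! hcon
  set T : Finset (F × F) := insert Q (S.image P) with hTdef
  have hTcard : T.card + 1 = k := by
    rw [hTdef, Finset.card_insert_of_notMem, Finset.card_image_of_injective _ hPinj]
    · omega
    · intro h
      obtain ⟨i, -, hi⟩ := Finset.mem_image.mp h
      exact hQD ⟨i, hi⟩
  have hT : ∀ p ∈ T, onCurve s t p := by
    intro p hp
    rcases Finset.mem_insert.mp hp with rfl | hp
    · exact hQ
    · obtain ⟨i, -, rfl⟩ := Finset.mem_image.mp hp
      exact hPcurve i
  have hvan : ∀ u : Fin k → F, (∀ i ∈ S, u ⬝ᵥ phiAff k (P i) = 0) →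
      ∀ p ∈ T, (xPart u).eval p.1 + p.2 * (yPart u).eval p.1 = 0 := by
    intro u hu p hp
    rw [← dotProduct_phiAff hk]
    rcases Finset.mem_insert.mp hp with rfl | hp
    · exact hcon u hu
    · obtain ⟨i, hi, rfl⟩ := Finset.mem_image.mp hp
      exact hu i hi
  obtain ⟨j, hj⟩ : ∃ j : Fin k, (j : ℕ) = if k % 2 = 0 then k / 2 else k - 1 :=
    ⟨⟨if k % 2 = 0 then k / 2 else k - 1, by split_ifs <;> omega⟩, rfl⟩
  obtain ⟨u, hu0, huj, hu⟩ := exists_vanish_of_card P S hS.le j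
  obtain ⟨i, hi⟩ := Function.ne_iff.mp hu0
  obtain ⟨w, hw0, hwi, hw⟩ := exists_vanish_of_card P S hS.le i
  have hxdeg : 2 * (xPart u).natDegree ≤ T.card := by
    have h1 := two_mul_natDegree_xPart_le u
    by_contra hlt
    have h2 : (j : ℕ) = (xPart u).natDegree := by
      rw [hj, if_pos (by omega)]
      omega
    have h3 := apply_eq_coeff_xPart u j (by omega)
    rw [huj, h2] at h3
    have h4 : xPart u = 0 := Polynomial.leadingCoeff_eq_zero.mp h3.symm
    rw [h4] at hlt
    simp at hlt
  have hydeg : yPart u ≠ 0 → 2 * (yPart u).natDegree + 3 ≤ T.card := by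
    intro hy
    have h1 := two_mul_natDegree_yPart_le u hy
    by_contra hlt
    have h2 : (j : ℕ) - (k / 2 + 1) = (yPart u).natDegree := by
      rw [hj, if_neg (by omega)]
      omega
    have h3 := apply_eq_coeff_yPart u j (by rw [hj, if_neg (by omega)]; omega)
    rw [huj, h2] at h3
    exact hy (Polynomial.leadingCoeff_eq_zero.mp h3.symm)
  obtain ⟨r, hr1, hr2⟩ := proportional_of_vanish s t T hT (xPart u) (yPart u) (xPart w) (yPart w)
    (by
      by_contra! h
      exact hu0 (eq_zero_of_xPart_yPart h.1 h.2))
    hxdeg hydeg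
    (by rw [hTcard]; exact two_mul_natDegree_xPart_le w)
    (fun h => by rw [hTcard]; exact two_mul_natDegree_yPart_le w h)
    (hvan u hu) (hvan w hw)
  have hwu : w i = r * u i := by
    by_cases hlt : (i : ℕ) < k / 2 + 1
    · rw [apply_eq_coeff_xPart w i hlt, apply_eq_coeff_xPart u i hlt, hr1, Polynomial.coeff_C_mul]
    · rw [apply_eq_coeff_yPart w i hlt, apply_eq_coeff_yPart u i hlt, hr2, Polynomial.coeff_C_mul]
  have hr0 : r = 0 := (mul_eq_zero.mp (hwu.symm.trans hwi)).resolve_right hi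
  subst hr0
  exact hw0 (eq_zero_of_xPart_yPart (by simpa using hr1) (by simpa using hr2))

lemma dTo_le_covRad {F : Type*} [DecidableEq F] {n : ℕ} (C : Set (Fin n → F)) (v : Fin n → F) :
    dTo v C ≤ covRad C := by
  refine le_csSup ⟨n, ?_⟩ ⟨v, rfl⟩
  rintro _ ⟨w, rfl⟩
  rcases C.eq_empty_or_nonempty with rfl | ⟨x, hx⟩
  · simp [dTo]
  · refine (Nat.sInf_le (Set.mem_image_of_mem (hammingDist w) hx)).trans ?_
    simpa using hammingDist_le_card_fintype (x := w) (y := x)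

/-- Suppose `C = C_Ω(D,kO)` has covering radius `k−1` and
`Q = (α,β)` is an affine rational point of `E` not in `D`. Then every word `v`
with syndrome `H(k)vᵀ = c·φ_k(Q)` for some nonzero `c` (i.e. every
`v ∈ C_Ω(D, kO−Q) ∖ C`) is a deep hole of `C`. -/
theorem syndrome_on_curve_point_gives_deep_hole
    (F : Type) [Field F] [Fintype F] [DecidableEq F]
    (hq : Odd (Fintype.card F))
    (s t : F) (hdisc : 4 * s ^ 3 + 27 * t ^ 2 ≠ 0)
    {n : ℕ} (k : ℕ) (P : Fin n → F × F)
    (hPinj : Function.Injective P)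
    (hPcurve : ∀ i, onCurve s t (P i))
    (hk2 : 2 ≤ k) (hkn : k ≤ n - 2)
    (hρ : covRad (resCode k P) = k - 1)
    (Q : F × F) (hQ : onCurve s t Q) (hQD : Q ∉ Set.range P)
    (v : Fin n → F) (c : F) (hc : c ≠ 0)
    (hv : Matrix.mulVec (Hmat k P) v = c • phiAff k Q) :
    dTo v (resCode k P) = covRad (resCode k P) := by
  refine le_antisymm (dTo_le_covRad _ _) ?_
  rw [hρ]
  by_contra! hlt
  obtain ⟨x, hx, hxd⟩ : dTo v (resCode k P) ∈ hammingDist v '' resCode k P :=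
    Nat.sInf_mem (Set.Nonempty.image _ ⟨0, Matrix.mulVec_zero _⟩)
  have hxC : Hmat k P *ᵥ x = 0 := hx
  obtain ⟨S, hsub, hScard⟩ := Finset.exists_superset_card_eq
    (s := Finset.univ.filter fun i => v i ≠ x i) (n := k - 2)
    (by
      change hammingDist v x ≤ k - 2
      omega)
    (by
      rw [Fintype.card_fin]
      omega)
  obtain ⟨u, hu, huQ⟩ := exists_vanish_ne_zero s t P hPinj hPcurve hk2 S (by omega) Q hQ hQD
  have hsyn : Hmat k P *ᵥ (v - x) = c • phiAff k Q := by
    rw [Matrix.mulVec_sub, hv, hxC, sub_zero]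
  have hzero : u ⬝ᵥ Hmat k P *ᵥ (v - x) = 0 := by
    rw [Matrix.dotProduct_mulVec]
    refine Finset.sum_eq_zero fun i _ => ?_
    by_cases hi : i ∈ S
    · have h1 : (u ᵥ* Hmat k P) i = 0 := hu i hi
      rw [h1, zero_mul]
    · have h1 : v i = x i := by
        by_contra hne
        exact hi (hsub (by simpa using hne))
      simp [h1]
  rw [hsyn, dotProduct_smul, smul_eq_mul] at hzero
  exact huQ ((mul_eq_zero.mp hzero).resolve_left hc)
end

section
/- Let 3 ≤ k ≤ n−2 and suppose the residue elliptic code C = C_Ω(D,kO) has covering radius k−1. Then every word v ∈ C_Ω(D,(k−1)O) ∖ C_Ω(D,kO), i.e., every v ∈ F_q^n with H(k−1)vᵀ = 0 but H(k)vᵀ ≠ 0, is a deep hole of C_Ω(D,kO). (This is the case P = O of the deep-hole construction for residue elliptic codes.) -/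
open Matrix BigOperators

/-- The short Weierstrass curve `y² = x³ + s x + t`. -/
def shortCurve {F : Type*} [Field F] (s t : F) : WeierstrassCurve.Affine F :=
  { a₁ := 0, a₂ := 0, a₃ := 0, a₄ := s, a₆ := t }

namespace WeierstrassCurve.Affine.CoordinateRing

open Polynomial

variable {F : Type*} [Field F] {W : WeierstrassCurve.Affine F}

/-- Evaluation of regular functions at an affine point of the curve. -/
noncomputable def evalAt {x y : F} (h : W.Equation x y) : W.CoordinateRing →ₐ[F] F :=
  AdjoinRoot.liftAlgHom W.polynomial (Polynomial.aeval x) y <| by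
    exact (congrFun (eval₂_evalRingHom x) y ▸ rfl : eval₂ (evalRingHom x) y W.polynomial =
      W.polynomial.evalEval x y).trans h

lemma evalAt_smul_one {x y : F} (h : W.Equation x y) (p : F[X]) :
    evalAt h (p • (1 : W.CoordinateRing)) = p.eval x := by
  rw [CoordinateRing.smul, mul_one]
  exact (AdjoinRoot.liftAlgHom_mk ..).trans (eval₂_C ..)

lemma evalAt_smul_Y {x y : F} (h : W.Equation x y) (p : F[X]) :
    evalAt h (p • mk W X) = p.eval x * y := by
  rw [CoordinateRing.smul, map_mul]
  exact congrArg₂ _ ((AdjoinRoot.liftAlgHom_mk ..).trans (eval₂_C ..))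
    ((AdjoinRoot.liftAlgHom_mk ..).trans (eval₂_X ..))

/-- Evaluation at finitely many affine points. -/
noncomputable def evalPi {ι : Type*} {Q : ι → F × F} (h : ∀ i, W.Equation (Q i).1 (Q i).2) :
    W.CoordinateRing →ₐ[F] (ι → F) :=
  AlgHom.pi fun i => evalAt (h i)

lemma evalPi_surjective {ι : Type*} [Fintype ι] {Q : ι → F × F} (hQ : Function.Injective Q)
    (h : ∀ i, W.Equation (Q i).1 (Q i).2) : Function.Surjective (evalPi h) := by
  classical
  have hinj : Function.Injective fun i => ((evalAt (h i) : W.CoordinateRing →* F)) := by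
    intro i j hij
    have key (r : W.CoordinateRing) : evalAt (h i) r = evalAt (h j) r := DFunLike.congr_fun hij r
    have h1 := key ((X : F[X]) • 1)
    have h2 := key ((1 : F[X]) • mk W X)
    simp only [evalAt_smul_one, evalAt_smul_Y, eval_X, eval_one, one_mul] at h1 h2
    exact hQ (Prod.ext h1 h2)
  have hli := (linearIndependent_monoidHom W.CoordinateRing F).comp _ hinj
  rw [Fintype.linearIndependent_iff] at hli
  change Function.Surjective (evalPi h).toLinearMap
  rw [← LinearMap.range_eq_top]
  by_contra hne
  obtain ⟨f, hf, hle⟩ := Submodule.exists_le_ker_of_lt_top _ (lt_top_iff_ne_top.2 hne)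
  apply hf
  have hexp (v : ι → F) : f v = ∑ i, f (Pi.single i 1) * v i := by
    conv_lhs => rw [pi_eq_sum_univ' v, map_sum]
    refine Finset.sum_congr rfl fun i _ => ?_
    rw [map_smul, smul_eq_mul, mul_comm]
  have hz := hli (fun i => f (Pi.single i 1)) <| by
    ext r
    have : f (evalPi h r) = 0 := hle ⟨r, rfl⟩
    rw [hexp] at this
    simpa [evalPi] using this
  ext v
  simp [hz]

/-- A nonzero function has at most as many zeros as the degree of its norm. -/
lemma card_le_natDegree_norm {ι : Type*} [Fintype ι] {Q : ι → F × F}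
    (hQ : Function.Injective Q) (h : ∀ i, W.Equation (Q i).1 (Q i).2)
    {f : W.CoordinateRing} (hf : f ≠ 0) (hev : evalPi h f = 0) :
    Fintype.card ι ≤ (Algebra.norm F[X] f).natDegree ∧
      ((Algebra.norm F[X] f).natDegree ≤ Fintype.card ι →
        ∀ g, evalPi h g = 0 → f ∣ g) := by
  have hfin := finrank_quotient_span_eq_natDegree_norm (CoordinateRing.basis W) hf
  have hmem : ∀ a ∈ Ideal.span {f}, evalPi h a = 0 := by
    intro a ha
    obtain ⟨c, rfl⟩ := Ideal.mem_span_singleton.1 ha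
    rw [map_mul, hev, zero_mul]
  let φ : (W.CoordinateRing ⧸ Ideal.span {f}) →ₐ[F] (ι → F) :=
    Ideal.Quotient.liftₐ _ (evalPi h) hmem
  have hφ (r : W.CoordinateRing) : φ (Ideal.Quotient.mk _ r) = evalPi h r := rfl
  have hsurj : Function.Surjective φ.toLinearMap := fun v => by
    obtain ⟨r, hr⟩ := evalPi_surjective hQ h v
    exact ⟨Ideal.Quotient.mk _ r, (hφ r).trans hr⟩
  have : Module.Finite F (W.CoordinateRing ⧸ Ideal.span {f}) :=
    Module.Finite.equiv (Ideal.quotientEquivDirectSum F (CoordinateRing.basis W)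
      (mt Ideal.span_singleton_eq_bot.1 hf)).symm
  have hle := LinearMap.finrank_le_finrank_of_surjective hsurj
  rw [Module.finrank_fintype_fun_eq_card, hfin] at hle
  refine ⟨hle, fun hge g hg => ?_⟩
  have hinj : Function.Injective φ.toLinearMap :=
    (LinearMap.injective_iff_surjective_of_finrank_eq_finrank
      (by rw [hfin, Module.finrank_fintype_fun_eq_card]; omega)).2 hsurj
  rw [← Ideal.mem_span_singleton, ← Ideal.Quotient.eq_zero_iff_mem]
  apply hinj
  rw [map_zero]
  exact (hφ g).trans hg

private lemma two_nsmul_coe (a : ℕ) : 2 • (a : WithBot ℕ) = ((2 * a : ℕ) : WithBot ℕ) := by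
  rw [two_nsmul, two_mul]
  rfl

lemma natDegree_norm_le {p q : F[X]} {d : ℕ} (hp : ∀ i, p.coeff i ≠ 0 → 2 * i ≤ d)
    (hq : ∀ i, q.coeff i ≠ 0 → 2 * i + 3 ≤ d) :
    (Algebra.norm F[X] (p • (1 : W.CoordinateRing) + q • mk W X)).natDegree ≤ d := by
  apply natDegree_le_of_degree_le
  rw [degree_norm_smul_basis]
  refine max_le ?_ ?_
  · rcases eq_or_ne p 0 with rfl | h0
    · simp
    · rw [degree_eq_natDegree h0]
      have := hp _ (leadingCoeff_ne_zero.2 h0)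
      rw [two_nsmul_coe]
      exact_mod_cast this
  · rcases eq_or_ne q 0 with rfl | h0
    · simp
    · rw [degree_eq_natDegree h0]
      have := hq _ (leadingCoeff_ne_zero.2 h0)
      rw [two_nsmul_coe]
      exact_mod_cast this

lemma exists_algebraMap_of_natDegree_norm_le_one {r : W.CoordinateRing}
    (hr : (Algebra.norm F[X] r).natDegree ≤ 1) : ∃ c : F, c • 1 = r := by
  have h0 : (Algebra.norm F[X] r).natDegree = 0 := by
    have := natDegree_norm_ne_one r
    omega
  obtain ⟨p, q, rfl⟩ := exists_smul_basis_eq r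
  have hd := degree_le_of_natDegree_le h0.le
  rw [degree_norm_smul_basis, max_le_iff] at hd
  obtain ⟨hp, hq⟩ := hd
  have hq0 : q = 0 := by
    by_contra hne
    rw [degree_eq_natDegree hne, two_nsmul_coe] at hq
    have : 2 * q.natDegree + 3 ≤ 0 := by exact_mod_cast hq
    omega
  have hp0 : p.natDegree = 0 := by
    by_contra hne
    rw [degree_eq_natDegree (by rintro rfl; simp at hne), two_nsmul_coe] at hp
    have : 2 * p.natDegree ≤ 0 := by exact_mod_cast hp
    omega
  rw [eq_C_of_natDegree_eq_zero hp0, hq0]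
  refine ⟨p.coeff 0, ?_⟩
  rw [zero_smul, add_zero, ← algebraMap_eq, algebraMap_smul]

end WeierstrassCurve.Affine.CoordinateRing

open Polynomial WeierstrassCurve.Affine in
/-- The function `∑ u_j x^i y^j` as an element of the coordinate ring. -/
noncomputable def funOfCoeffs {F : Type*} [Field F] (W : WeierstrassCurve.Affine F) (K : ℕ) :
    (Fin K → F) →ₗ[F] W.CoordinateRing :=
  Fintype.linearCombination F fun j : Fin K =>
    if (j : ℕ) ≤ K / 2 then (X ^ (j : ℕ) : F[X]) • (1 : W.CoordinateRing)
    else (X ^ ((j : ℕ) - K / 2 - 1) : F[X]) • CoordinateRing.mk W X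

section

open Polynomial WeierstrassCurve.Affine

variable {F : Type*} [Field F] {W : WeierstrassCurve.Affine F} {K : ℕ}

/-- The part of `∑ u_j x^i y^j` constant in `y`. -/
noncomputable def constPart (u : Fin K → F) : F[X] :=
  ∑ j : Fin K, if (j : ℕ) ≤ K / 2 then C (u j) * X ^ (j : ℕ) else 0

/-- The part of `∑ u_j x^i y^j` linear in `y`. -/
noncomputable def linPart (u : Fin K → F) : F[X] :=
  ∑ j : Fin K, if (j : ℕ) ≤ K / 2 then 0 else C (u j) * X ^ ((j : ℕ) - K / 2 - 1)

lemma funOfCoeffs_eq (u : Fin K → F) : funOfCoeffs W K u =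
    constPart u • (1 : W.CoordinateRing) + linPart u • CoordinateRing.mk W X := by
  rw [funOfCoeffs, Fintype.linearCombination_apply, constPart, linPart, Finset.sum_smul,
    Finset.sum_smul, ← Finset.sum_add_distrib]
  refine Finset.sum_congr rfl fun j _ => ?_
  split_ifs
  · rw [zero_smul, add_zero, mul_smul, ← algebraMap_eq, algebraMap_smul]
  · rw [zero_smul, zero_add, mul_smul, ← algebraMap_eq, algebraMap_smul]

lemma coeff_constPart (u : Fin K → F) (i : ℕ) : (constPart u).coeff i =
    ∑ j : Fin K, if (j : ℕ) ≤ K / 2 ∧ i = j then u j else 0 := by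
  rw [constPart, finsetSum_coeff]
  refine Finset.sum_congr rfl fun j _ => ?_
  split_ifs <;> simp_all [coeff_X_pow]

lemma coeff_linPart (u : Fin K → F) (i : ℕ) : (linPart u).coeff i =
    ∑ j : Fin K, if K / 2 < (j : ℕ) ∧ i = j - K / 2 - 1 then u j else 0 := by
  rw [linPart, finsetSum_coeff]
  refine Finset.sum_congr rfl fun j _ => ?_
  by_cases h : (j : ℕ) ≤ K / 2
  · simp [h]
  · simp [h, coeff_X_pow, not_le.1 h]

lemma funOfCoeffs_injective : Function.Injective (funOfCoeffs W K) := by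
  rw [injective_iff_map_eq_zero]
  intro u hu
  rw [funOfCoeffs_eq] at hu
  obtain ⟨h1, h2⟩ := CoordinateRing.smul_basis_eq_zero hu
  ext j
  by_cases hj : (j : ℕ) ≤ K / 2
  · have := coeff_constPart u j
    rw [h1, coeff_zero, Finset.sum_eq_single j, if_pos ⟨hj, rfl⟩] at this
    · exact this.symm
    · intro l _ hl
      rw [if_neg]
      rintro ⟨-, h⟩
      exact hl (Fin.ext h.symm)
    · simp
  · have := coeff_linPart u (j - K / 2 - 1)
    rw [h2, coeff_zero, Finset.sum_eq_single j, if_pos ⟨by omega, rfl⟩] at this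
    · exact this.symm
    · intro l _ hl
      rw [if_neg]
      rintro ⟨h_lt, h⟩
      exact hl (Fin.ext (by omega))
    · simp

lemma natDegree_norm_funOfCoeffs_le {u : Fin K → F} {d : ℕ}
    (hu : ∀ j, u j ≠ 0 → ((j : ℕ) ≤ K / 2 → 2 * (j : ℕ) ≤ d) ∧
      (K / 2 < (j : ℕ) → 2 * ((j : ℕ) - K / 2 - 1) + 3 ≤ d)) :
    (Algebra.norm F[X] (funOfCoeffs W K u)).natDegree ≤ d := by
  rw [funOfCoeffs_eq]
  apply CoordinateRing.natDegree_norm_le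
  · intro i hi
    rw [coeff_constPart] at hi
    obtain ⟨j, -, hj⟩ := Finset.exists_ne_zero_of_sum_ne_zero hi
    rw [ne_eq, ite_eq_right_iff, Classical.not_imp] at hj
    obtain ⟨⟨h1, rfl⟩, h2⟩ := hj
    exact (hu j h2).1 h1
  · intro i hi
    rw [coeff_linPart] at hi
    obtain ⟨j, -, hj⟩ := Finset.exists_ne_zero_of_sum_ne_zero hi
    rw [ne_eq, ite_eq_right_iff, Classical.not_imp] at hj
    obtain ⟨⟨h1, rfl⟩, h2⟩ := hj
    exact (hu j h2).2 h1

lemma evalAt_funOfCoeffs {x y : F} (h : W.Equation x y) (u : Fin K → F) :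
    CoordinateRing.evalAt h (funOfCoeffs W K u) = ∑ j, u j * phiAff K (x, y) j := by
  rw [funOfCoeffs, Fintype.linearCombination_apply, map_sum]
  refine Finset.sum_congr rfl fun j _ => ?_
  rw [map_smul, smul_eq_mul, phiAff]
  split_ifs
  · simp [CoordinateRing.evalAt_smul_one]
  · rw [CoordinateRing.evalAt_smul_Y, eval_pow, eval_X, mul_comm y]

/-- Functions in `L(KO)` take arbitrary values at `K - 1 ≥ 1` distinct affine points. -/
lemma evalPi_funOfCoeffs_surjective {ι : Type*} [Fintype ι] [Nonempty ι] {Q : ι → F × F}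
    (hQ : Function.Injective Q) (h : ∀ i, W.Equation (Q i).1 (Q i).2)
    (hK : Fintype.card ι + 1 = K) :
    Function.Surjective ((CoordinateRing.evalPi h).toLinearMap ∘ₗ funOfCoeffs W K) := by
  have hcard : 0 < Fintype.card ι := Fintype.card_pos
  set E := (CoordinateRing.evalPi h).toLinearMap ∘ₗ funOfCoeffs W K with hE
  have hEu (u) (hu : u ∈ LinearMap.ker E) : CoordinateRing.evalPi h (funOfCoeffs W K u) = 0 := hu
  have hker : Module.finrank F (LinearMap.ker E) ≤ 1 := by
    let l : Fin K := ⟨if K % 2 = 0 then K / 2 else K - 1, by split_ifs <;> omega⟩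
    by_cases hex : ∃ u ∈ LinearMap.ker E, u ≠ 0 ∧ u l = 0
    · obtain ⟨u, hu, hu0, hul⟩ := hex
      have hf0 : funOfCoeffs W K u ≠ 0 := (map_ne_zero_iff _ funOfCoeffs_injective).2 hu0
      have hdu : (Algebra.norm F[X] (funOfCoeffs W K u)).natDegree ≤ Fintype.card ι := by
        apply natDegree_norm_funOfCoeffs_le
        intro j hj
        have hjl : (j : ℕ) ≠ l := fun e => hj (Fin.ext e ▸ hul)
        have := j.2
        dsimp only [l] at hjl
        split_ifs at hjl <;> constructor <;> intro <;> omega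
      obtain ⟨hge, hdvd⟩ := CoordinateRing.card_le_natDegree_norm hQ h hf0 (hEu u hu)
      refine finrank_le_one ⟨u, hu⟩ fun ⟨w, hw⟩ => ?_
      obtain ⟨r, hr⟩ := hdvd hdu _ (hEu w hw)
      have hdw : (Algebra.norm F[X] (funOfCoeffs W K w)).natDegree ≤ K := by
        apply natDegree_norm_funOfCoeffs_le
        intro j hj
        have := j.2
        constructor <;> intro <;> omega
      have hr1 : (Algebra.norm F[X] r).natDegree ≤ 1 := by
        rcases eq_or_ne r 0 with rfl | hr0
        · have := Module.Finite.of_basis (CoordinateRing.basis W)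
          rw [Algebra.norm_zero, natDegree_zero]
          exact zero_le_one
        · rw [hr, map_mul, natDegree_mul (Algebra.norm_ne_zero_iff_of_basis
            (CoordinateRing.basis W) |>.2 hf0) (Algebra.norm_ne_zero_iff_of_basis
            (CoordinateRing.basis W) |>.2 hr0)] at hdw
          omega
      obtain ⟨c, rfl⟩ := CoordinateRing.exists_algebraMap_of_natDegree_norm_le_one hr1
      refine ⟨c, Subtype.ext (funOfCoeffs_injective (W := W) ?_)⟩
      rw [hr]
      simp
    · push Not at hex
      let φ : LinearMap.ker E →ₗ[F] F := LinearMap.proj l ∘ₗ (LinearMap.ker E).subtype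
      have hφ : Function.Injective φ := by
        rw [injective_iff_map_eq_zero]
        rintro ⟨u, hu⟩ hul
        by_contra hne
        exact hex u hu (fun e => hne (Subtype.ext e)) hul
      simpa using LinearMap.finrank_le_finrank_of_injective hφ
  have hrk := E.finrank_range_add_finrank_ker
  rw [Module.finrank_fin_fun] at hrk
  rw [← LinearMap.range_eq_top]
  apply Submodule.eq_top_of_finrank_eq
  have := Submodule.finrank_le (LinearMap.range E)
  rw [Module.finrank_fintype_fun_eq_card] at this ⊢
  omega

/-- Columns of `H(K)` at `K - 1 ≥ 1` distinct affine points are linearly independent. -/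
lemma eq_zero_of_sum_mul_phiAff_eq_zero {ι : Type*} [Fintype ι] [Nonempty ι] {Q : ι → F × F}
    (hQ : Function.Injective Q) (h : ∀ i, W.Equation (Q i).1 (Q i).2)
    (hK : Fintype.card ι + 1 = K) {w : ι → F}
    (hw : ∀ j : Fin K, ∑ i, phiAff K (Q i) j * w i = 0) : w = 0 := by
  classical
  ext i
  obtain ⟨u, hu⟩ := evalPi_funOfCoeffs_surjective hQ h hK (Pi.single i 1)
  have hu' (l : ι) : ∑ j, u j * phiAff K (Q l) j = (Pi.single i 1 : ι → F) l := by
    rw [← hu, ← evalAt_funOfCoeffs (h l)]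
    rfl
  have : ∑ l, (Pi.single i 1 : ι → F) l * w l = 0 := by
    simp_rw [← hu', Finset.sum_mul]
    rw [Finset.sum_comm]
    refine Finset.sum_eq_zero fun j _ => ?_
    simp_rw [mul_assoc]
    rw [← Finset.mul_sum, hw, mul_zero]
  simpa [Pi.single_apply] using this

end

/-- The minimum distance of `C_Ω(D, KO)` is at least `K`. -/
lemma le_hammingNorm_of_mem_resCode {F : Type*} [Field F] [DecidableEq F] {s t : F} {n K : ℕ}
    {P : Fin n → F × F} (hPinj : Function.Injective P) (hPcurve : ∀ i, onCurve s t (P i))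
    (hK : 2 ≤ K) (hKn : K ≤ n + 1) {w : Fin n → F} (hw : w ∈ resCode K P) (hw0 : w ≠ 0) :
    K ≤ hammingNorm w := by
  by_contra! hlt
  obtain ⟨S, hS, hScard⟩ := Finset.exists_superset_card_eq
    (s := Finset.univ.filter fun i => w i ≠ 0) (n := K - 1)
    (by simpa [hammingNorm] using Nat.le_sub_one_of_lt hlt) (by simpa using hKn)
  have hout (i) (hi : i ∉ S) : w i = 0 := by
    by_contra hne
    exact hi (hS (by simpa using hne))
  have hne : Nonempty S := by
    rw [← Fintype.card_pos_iff, Fintype.card_coe]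
    omega
  have hz := eq_zero_of_sum_mul_phiAff_eq_zero (W := shortCurve s t) (K := K)
    (Q := fun i : S => P i) (w := fun i : S => w i) (hPinj.comp Subtype.val_injective)
    (fun i => by
      rw [WeierstrassCurve.Affine.equation_iff]
      have := hPcurve i
      simpa [shortCurve, onCurve] using this)
    (by rw [Fintype.card_coe]; omega)
    (fun j => by
      have := congrFun hw j
      rw [Finset.sum_coe_sort S fun i => phiAff K (P i) j * w i]
      rw [Finset.sum_subset (Finset.subset_univ S) fun i _ hi => by rw [hout i hi, mul_zero]]
      exact this)
  apply hw0
  ext i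
  by_cases hi : i ∈ S
  · exact congrFun hz ⟨i, hi⟩
  · exact hout i hi

/-- Passing from `H(k)` to `H(k-1)` drops rows. -/
lemma resCode_subset_pred {F : Type*} [Field F] {n k : ℕ} (P : Fin n → F × F) (hk : 3 ≤ k) :
    resCode k P ⊆ resCode (k - 1) P := by
  intro c hc
  have key : ∀ j : Fin (k - 1), ∃ i : Fin k, ∀ Q : F × F, phiAff (k - 1) Q j = phiAff k Q i := by
    intro j
    have hj := j.2
    by_cases h : (j : ℕ) ≤ (k - 1) / 2
    · refine ⟨⟨j, by omega⟩, fun Q => ?_⟩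
      rw [phiAff, phiAff, if_pos h, if_pos (show (j : ℕ) ≤ k / 2 by omega)]
    · refine ⟨⟨j - (k - 1) / 2 - 1 + (k / 2 + 1), by omega⟩, fun Q => ?_⟩
      rw [phiAff, phiAff, if_neg h, if_neg (by simp only; omega)]
      congr 2
      simp only
      omega
  ext j
  obtain ⟨i, hi⟩ := key j
  have := congrFun hc i
  simpa [Matrix.mulVec, dotProduct, Hmat, hi] using this

/-- Suppose `3 ≤ k ≤ n−2` and `C = C_Ω(D,kO)` has covering radius `k−1`.
Then every word `v` with `H(k−1)vᵀ = 0` but `H(k)vᵀ ≠ 0`, i.e. every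
`v ∈ C_Ω(D,(k−1)O) ∖ C_Ω(D,kO)`, is a deep hole of `C_Ω(D,kO)`. -/
theorem case_P_eq_O_gives_deep_hole_residue
    (F : Type) [Field F] [Fintype F] [DecidableEq F]
    (hq : Odd (Fintype.card F))
    (s t : F) (hdisc : 4 * s ^ 3 + 27 * t ^ 2 ≠ 0)
    {n : ℕ} (k : ℕ) (P : Fin n → F × F)
    (hPinj : Function.Injective P)
    (hPcurve : ∀ i, onCurve s t (P i))
    (hk3 : 3 ≤ k) (hkn : k ≤ n - 2)
    (hρ : covRad (resCode k P) = k - 1)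
    (v : Fin n → F)
    (hv1 : Matrix.mulVec (Hmat (k - 1) P) v = 0)
    (hv2 : Matrix.mulVec (Hmat k P) v ≠ 0) :
    dTo v (resCode k P) = covRad (resCode k P) := by
  have h0 : (0 : Fin n → F) ∈ resCode k P := Matrix.mulVec_zero _
  apply le_antisymm
  · refine le_csSup ⟨n, ?_⟩ ⟨v, rfl⟩
    rintro _ ⟨u, rfl⟩
    refine (Nat.sInf_le (Set.mem_image_of_mem (hammingDist u) h0)).trans ?_
    simpa using hammingDist_le_card_fintype (x := u) (y := 0)
  · rw [hρ]
    refine le_csInf (Set.Nonempty.image (hammingDist v) (Set.nonempty_of_mem h0)) ?_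
    rintro _ ⟨c, hc, rfl⟩
    rw [hammingDist_comm, hammingDist_eq_hammingNorm]
    refine le_hammingNorm_of_mem_resCode hPinj hPcurve (by omega) (by omega) ?_ ?_
    · have hc' : Matrix.mulVec (Hmat (k - 1) P) c = 0 := resCode_subset_pred P hk3 hc
      change Matrix.mulVec (Hmat (k - 1) P) (-c + v) = 0
      rw [Matrix.mulVec_add, Matrix.mulVec_neg, hv1, hc', neg_zero, add_zero]
    · intro e
      rw [← neg_add_eq_zero.1 e] at hv2
      exact hv2 hc
end
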